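/- arXiv:2409.15734 — 11 statements merged into one kernel-verified Lean document; each statement's English description precedes it below -/
import Mathlib

section
/- Suppose the accuracy conditions ‖∇̄²f − ∇²f‖ ≤ κ_h·Δ and ‖ḡ − g‖ ≤ κ_g·Δ² hold for some κ_h, κ_g > 0 and some 0 < Δ ≤ Δ_max. Then the estimated Lagrangian Hessian satisfies ‖H̄‖ ≤ κ_h·Δ_max + L_{∇f} + (√m·L_G/√κ₁)·(κ_g·Δ_max² + κ_{∇f}). -/
open scoped RealInnerProductSpace
open ContinuousLinearMap

noncomputable section

/-- If `v` solves the normal equation `G Gᵀ v = G u` and `G Gᵀ` is bounded below by `κ`,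
then `√κ ‖v‖ ≤ ‖u‖`. -/
lemma sqrt_mul_norm_le_of_apply_adjoint_eq {E F : Type*}
    [NormedAddCommGroup E] [InnerProductSpace ℝ E] [CompleteSpace E]
    [NormedAddCommGroup F] [InnerProductSpace ℝ F] [CompleteSpace F]
    (G : E →L[ℝ] F) {κ : ℝ} {u : E} {v : F}
    (hκ : κ * ‖v‖ ^ 2 ≤ ⟪G (adjoint G v), v⟫) (h : G (adjoint G v) = G u) :
    Real.sqrt κ * ‖v‖ ≤ ‖u‖ := by
  have hsq : ⟪G (adjoint G v), v⟫ = ‖adjoint G v‖ ^ 2 := by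
    rw [← adjoint_inner_right, real_inner_self_eq_norm_sq]
  have hcs : ‖adjoint G v‖ ^ 2 ≤ ‖u‖ * ‖adjoint G v‖ := by
    rw [← hsq, h, ← adjoint_inner_right]
    exact real_inner_le_norm _ _
  have hle : ‖adjoint G v‖ ≤ ‖u‖ := by
    by_contra! hlt
    nlinarith [norm_nonneg u, norm_nonneg (adjoint G v)]
  rw [hsq] at hκ
  calc Real.sqrt κ * ‖v‖ = Real.sqrt (κ * ‖v‖ ^ 2) := by
        rw [Real.sqrt_mul' _ (sq_nonneg _), Real.sqrt_sq (norm_nonneg v)]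
    _ ≤ Real.sqrt (‖adjoint G v‖ ^ 2) := Real.sqrt_le_sqrt hκ
    _ = ‖adjoint G v‖ := Real.sqrt_sq (norm_nonneg _)
    _ ≤ ‖u‖ := hle

/-- The `ℓ¹` norm is at most `√m` times the Euclidean norm. -/
lemma sum_norm_apply_le_sqrt_card_mul_norm {m : ℕ} (v : EuclideanSpace ℝ (Fin m)) :
    ∑ i, ‖v i‖ ≤ Real.sqrt m * ‖v‖ := by
  have h := sq_sum_le_card_mul_sum_sq (s := Finset.univ) (f := fun i => ‖v i‖)
  rw [EuclideanSpace.norm_eq, ← Real.sqrt_mul (Nat.cast_nonneg m)]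
  exact Real.le_sqrt_of_sq_le (by simpa using h)

/-- A combination of vectors of norm at most `L` has norm at most `√m L` times the Euclidean norm
of its coefficients. -/
lemma norm_sum_smul_le_sqrt_card_mul {m : ℕ} {E : Type*} [SeminormedAddCommGroup E]
    [NormedSpace ℝ E] (v : EuclideanSpace ℝ (Fin m)) (x : Fin m → E) {L : ℝ} (hL : 0 ≤ L)
    (hx : ∀ i, ‖x i‖ ≤ L) :
    ‖∑ i, v i • x i‖ ≤ Real.sqrt m * L * ‖v‖ :=
  calc ‖∑ i, v i • x i‖ ≤ ∑ i, ‖v i‖ * L := by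
        refine norm_sum_le_of_le _ fun i _ => ?_
        rw [norm_smul]
        exact mul_le_mul_of_nonneg_left (hx i) (norm_nonneg _)
    _ = (∑ i, ‖v i‖) * L := (Finset.sum_mul ..).symm
    _ ≤ Real.sqrt m * ‖v‖ * L :=
        mul_le_mul_of_nonneg_right (sum_norm_apply_le_sqrt_card_mul_norm v) hL
    _ = Real.sqrt m * L * ‖v‖ := by ring

/-- boundedness of the estimated Lagrangian Hessian (Lemma 1 of the paper).
Vectors live in `EuclideanSpace ℝ (Fin d)`; matrices are represented by (continuous) linear
maps between Euclidean spaces, so that `‖·‖` is the spectral norm, and `Gᵀ` is the adjoint.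
`W` plays the role of `(G·Gᵀ)⁻¹` (a two-sided inverse of `G·Gᵀ`), the multiplier estimate is
`λ̄ = −(G·Gᵀ)⁻¹·G·ḡ = −W (G ḡ)`, and the estimated Lagrangian Hessian is
`H̄ = ∇̄²f + Σᵢ λ̄ⁱ·∇²cⁱ`. -/
theorem stmt_0 {d m : ℕ} (hm : 1 ≤ m) (hmd : m ≤ d)
    (Hf Hfbar : EuclideanSpace ℝ (Fin d) →L[ℝ] EuclideanSpace ℝ (Fin d))
    (Hc : Fin m → (EuclideanSpace ℝ (Fin d) →L[ℝ] EuclideanSpace ℝ (Fin d)))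
    (g gbar : EuclideanSpace ℝ (Fin d))
    (G : EuclideanSpace ℝ (Fin d) →L[ℝ] EuclideanSpace ℝ (Fin m))
    (W : EuclideanSpace ℝ (Fin m) →L[ℝ] EuclideanSpace ℝ (Fin m))
    (κ₁ L_G L_gradf κ_gradf κ_h κ_g Δ Δmax : ℝ)
    (hHfsym : IsSelfAdjoint Hf) (hHfbarsym : IsSelfAdjoint Hfbar)
    (hHcsym : ∀ i, IsSelfAdjoint (Hc i))
    (hκ₁ : 0 < κ₁)
    (hGpos : ∀ v : EuclideanSpace ℝ (Fin m), κ₁ * ‖v‖ ^ 2 ≤ ⟪G (adjoint G v), v⟫)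
    (hW₁ : ∀ v, W (G (adjoint G v)) = v)
    (hW₂ : ∀ v, G (adjoint G (W v)) = v)
    (hHc : ∀ i, ‖Hc i‖ ≤ L_G)
    (hHfb : ‖Hf‖ ≤ L_gradf)
    (hgb : ‖g‖ ≤ κ_gradf)
    (hκh : 0 < κ_h) (hκg : 0 < κ_g) (hΔ : 0 < Δ) (hΔmax : Δ ≤ Δmax)
    (hacc_h : ‖Hfbar - Hf‖ ≤ κ_h * Δ)
    (hacc_g : ‖gbar - g‖ ≤ κ_g * Δ ^ 2) :
    ‖Hfbar + ∑ i, (-(W (G gbar))) i • Hc i‖ ≤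
      κ_h * Δmax + L_gradf +
        Real.sqrt m * L_G / Real.sqrt κ₁ * (κ_g * Δmax ^ 2 + κ_gradf) := by
  have hL : 0 ≤ L_G := (norm_nonneg _).trans (hHc ⟨0, hm⟩)
  have hHfbar : ‖Hfbar‖ ≤ κ_h * Δmax + L_gradf :=
    calc ‖Hfbar‖ ≤ ‖Hfbar - Hf‖ + ‖Hf‖ := norm_le_norm_sub_add _ _
      _ ≤ κ_h * Δ + L_gradf := add_le_add hacc_h hHfb
      _ ≤ κ_h * Δmax + L_gradf := by gcongr
  have hgbar : ‖gbar‖ ≤ κ_g * Δmax ^ 2 + κ_gradf :=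
    calc ‖gbar‖ ≤ ‖gbar - g‖ + ‖g‖ := norm_le_norm_sub_add _ _
      _ ≤ κ_g * Δ ^ 2 + κ_gradf := add_le_add hacc_g hgb
      _ ≤ κ_g * Δmax ^ 2 + κ_gradf := by gcongr
  have hmult : Real.sqrt κ₁ * ‖W (G gbar)‖ ≤ ‖gbar‖ :=
    sqrt_mul_norm_le_of_apply_adjoint_eq G (hGpos _) (hW₂ _)
  have hsum : ‖∑ i, (-(W (G gbar))) i • Hc i‖ ≤
      Real.sqrt m * L_G / Real.sqrt κ₁ * (κ_g * Δmax ^ 2 + κ_gradf) :=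
    calc ‖∑ i, (-(W (G gbar))) i • Hc i‖ ≤ Real.sqrt m * L_G * ‖-(W (G gbar))‖ :=
          norm_sum_smul_le_sqrt_card_mul _ Hc hL hHc
      _ = Real.sqrt m * L_G / Real.sqrt κ₁ * (Real.sqrt κ₁ * ‖W (G gbar)‖) := by
          have := (Real.sqrt_pos.2 hκ₁).ne'
          rw [norm_neg]
          field_simp
      _ ≤ Real.sqrt m * L_G / Real.sqrt κ₁ * (κ_g * Δmax ^ 2 + κ_gradf) := by
          gcongr
          exact hmult.trans hgbar
  exact (norm_add_le _ _).trans (add_le_add hHfbar hsum)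
end
end

section
/- Suppose the accuracy conditions ‖∇̄²f − ∇²f‖ ≤ κ_h·Δ and ‖ḡ − g‖ ≤ κ_g·Δ² hold for some κ_h, κ_g > 0 and some 0 < Δ ≤ Δ_max. Then, with κ_H = κ_h + √m·κ_g·L_G·Δ_max/√κ₁, one has ‖∇²L − H̄‖ ≤ κ_H·Δ and |τ⁺ − τ̄⁺| ≤ κ_H·Δ. -/
open scoped RealInnerProductSpace
open ContinuousLinearMap

noncomputable section

/-- If `G Gᵀ ⪰ κ` with right inverse `W` then `‖W G x‖ ≤ ‖x‖ / √κ`. -/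
theorem norm_gram_inverse_apply_le {E F : Type*} [NormedAddCommGroup E] [InnerProductSpace ℝ E]
    [CompleteSpace E] [NormedAddCommGroup F] [InnerProductSpace ℝ F] [CompleteSpace F]
    (G : E →L[ℝ] F) (W : F →L[ℝ] F) {κ : ℝ} (hκ : 0 < κ)
    (hG : ∀ v, κ * ‖v‖ ^ 2 ≤ ⟪G (adjoint G v), v⟫) (hW : ∀ v, G (adjoint G (W v)) = v) (x : E) :
    ‖W (G x)‖ ≤ ‖x‖ / Real.sqrt κ := by
  set v := W (G x) with hv
  have h_inner : ⟪G (adjoint G v), v⟫ = ⟪x, adjoint G v⟫ := by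
    rw [hv, hW, adjoint_inner_right]
  have h_sq : ‖adjoint G v‖ ^ 2 = ⟪G (adjoint G v), v⟫ := by
    rw [← adjoint_inner_right, real_inner_self_eq_norm_sq]
  have h_le : ‖adjoint G v‖ ≤ ‖x‖ := by
    by_contra! h
    have := real_inner_le_norm x (adjoint G v)
    nlinarith [norm_nonneg x]
  rw [le_div_iff₀ (Real.sqrt_pos.2 hκ)]
  refine le_of_sq_le_sq ?_ (norm_nonneg x)
  calc (‖v‖ * Real.sqrt κ) ^ 2 = κ * ‖v‖ ^ 2 := by rw [mul_pow, Real.sq_sqrt hκ.le, mul_comm]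
    _ ≤ ‖adjoint G v‖ ^ 2 := by rw [h_sq]; exact hG v
    _ ≤ ‖x‖ ^ 2 := by gcongr

theorem norm_sum_smul_le_sqrt_card {ι E : Type*} [Fintype ι] [NormedAddCommGroup E]
    [NormedSpace ℝ E] (v : EuclideanSpace ℝ ι) (A : ι → E) {L : ℝ} (hL : 0 ≤ L)
    (hA : ∀ i, ‖A i‖ ≤ L) :
    ‖∑ i, v i • A i‖ ≤ Real.sqrt (Fintype.card ι) * ‖v‖ * L := by
  have h_cs : ∑ i, ‖v i‖ ≤ Real.sqrt (Fintype.card ι) * ‖v‖ := by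
    rw [EuclideanSpace.norm_eq, ← Real.sqrt_mul (Nat.cast_nonneg _)]
    exact Real.le_sqrt_of_sq_le (sq_sum_le_card_mul_sum_sq (s := Finset.univ))
  calc ‖∑ i, v i • A i‖ ≤ ∑ i, ‖v i‖ * L := norm_sum_le_of_le _ fun i _ => by
        rw [norm_smul]; gcongr; exact hA i
    _ = (∑ i, ‖v i‖) * L := by rw [Finset.sum_mul]
    _ ≤ _ := by gcongr

theorem add_sum_neg_smul_sub_add_sum_neg_smul {ι E : Type*} [Fintype ι] [AddCommGroup E]
    [Module ℝ E] (x y : E) (v w : EuclideanSpace ℝ ι) (A : ι → E) :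
    (x + ∑ i, (-v) i • A i) - (y + ∑ i, (-w) i • A i) = ∑ i, (w - v) i • A i - (y - x) := by
  simp only [PiLp.sub_apply, PiLp.neg_apply, sub_smul, neg_smul, Finset.sum_sub_distrib,
    Finset.sum_neg_distrib]
  abel

theorem abs_iInf_sub_iInf_le {ι : Type*} [Nonempty ι] {a b : ι → ℝ} {K : ℝ}
    (ha : BddBelow (Set.range a)) (hb : BddBelow (Set.range b)) (h : ∀ i, |a i - b i| ≤ K) :
    |(⨅ i, a i) - ⨅ i, b i| ≤ K := by
  rw [abs_sub_le_iff]
  constructor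
  · have : (⨅ i, a i) - K ≤ ⨅ i, b i := le_ciInf fun i => by
      linarith [ciInf_le ha i, (abs_sub_le_iff.1 (h i)).1]
    linarith
  · have : (⨅ i, b i) - K ≤ ⨅ i, a i := le_ciInf fun i => by
      linarith [ciInf_le hb i, (abs_sub_le_iff.1 (h i)).2]
    linarith

theorem abs_inner_adjoint_comp_le {E F : Type*} [NormedAddCommGroup E] [InnerProductSpace ℝ E]
    [CompleteSpace E] [NormedAddCommGroup F] [InnerProductSpace ℝ F] [CompleteSpace F]
    {Z : E →L[ℝ] F} (hZ : (adjoint Z).comp Z = ContinuousLinearMap.id ℝ _) (A : F →L[ℝ] F)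
    (u : Metric.sphere (0 : E) 1) : |⟪adjoint Z (A (Z u)), (u : E)⟫| ≤ ‖A‖ := by
  have hu : ‖(u : E)‖ = 1 := by simp
  have hZu : ‖Z u‖ = 1 := by
    rw [(norm_map_iff_adjoint_comp_self Z).2 hZ, hu]
  rw [adjoint_inner_left]
  calc |⟪A (Z u), Z u⟫| ≤ ‖A (Z u)‖ * ‖Z u‖ := abs_real_inner_le_norm _ _
    _ ≤ ‖A‖ * ‖Z u‖ * ‖Z u‖ := by gcongr; exact A.le_opNorm _
    _ = ‖A‖ := by rw [hZu]; ring

/-- The negative part of the smallest reduced eigenvalue is `1`-Lipschitz in the operator. -/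
theorem abs_negPart_iInf_rayleigh_sub_le {E F : Type*} [NormedAddCommGroup E]
    [InnerProductSpace ℝ E] [CompleteSpace E] [Nontrivial E] [NormedAddCommGroup F]
    [InnerProductSpace ℝ F] [CompleteSpace F] {Z : E →L[ℝ] F}
    (hZ : (adjoint Z).comp Z = ContinuousLinearMap.id ℝ _) (A B : F →L[ℝ] F) :
    |(|min (⨅ u : Metric.sphere (0 : E) 1, ⟪adjoint Z (A (Z u)), (u : E)⟫) 0|) -
      (|min (⨅ u : Metric.sphere (0 : E) 1, ⟪adjoint Z (B (Z u)), (u : E)⟫) 0|)| ≤ ‖A - B‖ := by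
  have : Nonempty (Metric.sphere (0 : E) 1) :=
    (NormedSpace.sphere_nonempty.2 zero_le_one).to_subtype
  have h_bdd (C : F →L[ℝ] F) : BddBelow
      (Set.range fun u : Metric.sphere (0 : E) 1 => ⟪adjoint Z (C (Z u)), (u : E)⟫) := by
    refine ⟨-‖C‖, ?_⟩
    rintro _ ⟨u, rfl⟩
    exact (abs_le.1 (abs_inner_adjoint_comp_le hZ C u)).1
  refine (abs_abs_sub_abs_le _ _).trans ((abs_min_sub_min_le_max _ _ _ _).trans ?_)
  rw [sub_self, abs_zero, max_eq_left (abs_nonneg _)]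
  refine abs_iInf_sub_iInf_le (h_bdd A) (h_bdd B) fun u => ?_
  rw [← inner_sub_left, ← map_sub, ← sub_apply]
  exact abs_inner_adjoint_comp_le hZ (A - B) u

/-- accuracy of the estimated Lagrangian Hessian and of the negative-curvature
estimate (Lemma 2 of the paper).  Matrices are represented by continuous linear maps between
Euclidean spaces (`‖·‖` is the spectral norm, `Gᵀ` is the adjoint), `W` plays the role of
`(G·Gᵀ)⁻¹`, `Z` has orthonormal columns spanning `ker G`
(`Zᵀ·Z = I`, `G·Z = 0`, `Z·Zᵀ = I − Gᵀ·(G·Gᵀ)⁻¹·G`), and the smallest eigenvalue of a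
(self-adjoint) reduced matrix is expressed as the infimum of its Rayleigh quotient over the
unit sphere. -/
theorem stmt_2 {d m : ℕ} (hm : 1 ≤ m) (hmd : m < d)
    (Hf Hfbar : EuclideanSpace ℝ (Fin d) →L[ℝ] EuclideanSpace ℝ (Fin d))
    (Hc : Fin m → (EuclideanSpace ℝ (Fin d) →L[ℝ] EuclideanSpace ℝ (Fin d)))
    (g gbar : EuclideanSpace ℝ (Fin d))
    (G : EuclideanSpace ℝ (Fin d) →L[ℝ] EuclideanSpace ℝ (Fin m))
    (W : EuclideanSpace ℝ (Fin m) →L[ℝ] EuclideanSpace ℝ (Fin m))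
    (Z : EuclideanSpace ℝ (Fin (d - m)) →L[ℝ] EuclideanSpace ℝ (Fin d))
    (κ₁ L_G κ_h κ_g Δ Δmax : ℝ)
    (hHfsym : IsSelfAdjoint Hf) (hHfbarsym : IsSelfAdjoint Hfbar)
    (hHcsym : ∀ i, IsSelfAdjoint (Hc i))
    (hκ₁ : 0 < κ₁)
    (hGpos : ∀ v : EuclideanSpace ℝ (Fin m), κ₁ * ‖v‖ ^ 2 ≤ ⟪G (adjoint G v), v⟫)
    (hW₁ : ∀ v, W (G (adjoint G v)) = v)
    (hW₂ : ∀ v, G (adjoint G (W v)) = v)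
    (hZ₁ : (adjoint Z).comp Z = ContinuousLinearMap.id ℝ _)
    (hZ₂ : G.comp Z = 0)
    (hZ₃ : Z.comp (adjoint Z) =
      ContinuousLinearMap.id ℝ _ - (adjoint G).comp (W.comp G))
    (hHc : ∀ i, ‖Hc i‖ ≤ L_G)
    (hκh : 0 < κ_h) (hκg : 0 < κ_g) (hΔ : 0 < Δ) (hΔmax : Δ ≤ Δmax)
    (hacc_h : ‖Hfbar - Hf‖ ≤ κ_h * Δ)
    (hacc_g : ‖gbar - g‖ ≤ κ_g * Δ ^ 2) :
    ‖(Hf + ∑ i, (-(W (G g))) i • Hc i) - (Hfbar + ∑ i, (-(W (G gbar))) i • Hc i)‖ ≤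
        (κ_h + Real.sqrt m * κ_g * L_G * Δmax / Real.sqrt κ₁) * Δ ∧
      |(|min (⨅ u : Metric.sphere (0 : EuclideanSpace ℝ (Fin (d - m))) 1,
              ⟪(adjoint Z) ((Hf + ∑ i, (-(W (G g))) i • Hc i) (Z u)),
                (u : EuclideanSpace ℝ (Fin (d - m)))⟫) 0|) -
        (|min (⨅ u : Metric.sphere (0 : EuclideanSpace ℝ (Fin (d - m))) 1,
              ⟪(adjoint Z) ((Hfbar + ∑ i, (-(W (G gbar))) i • Hc i) (Z u)),
                (u : EuclideanSpace ℝ (Fin (d - m)))⟫) 0|)| ≤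
        (κ_h + Real.sqrt m * κ_g * L_G * Δmax / Real.sqrt κ₁) * Δ := by
  have hL : 0 ≤ L_G := (norm_nonneg _).trans (hHc ⟨0, hm⟩)
  have h_hess : ‖(Hf + ∑ i, (-(W (G g))) i • Hc i) - (Hfbar + ∑ i, (-(W (G gbar))) i • Hc i)‖ ≤
      (κ_h + Real.sqrt m * κ_g * L_G * Δmax / Real.sqrt κ₁) * Δ := by
    have h_split : (Hf + ∑ i, (-(W (G g))) i • Hc i) - (Hfbar + ∑ i, (-(W (G gbar))) i • Hc i) =
        ∑ i, (W (G (gbar - g))) i • Hc i - (Hfbar - Hf) := by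
      rw [map_sub, map_sub]
      exact add_sum_neg_smul_sub_add_sum_neg_smul _ _ _ _ _
    have h_mult : ‖W (G (gbar - g))‖ ≤ κ_g * (Δmax * Δ) / Real.sqrt κ₁ := by
      refine (norm_gram_inverse_apply_le G W hκ₁ hGpos hW₂ _).trans ?_
      gcongr
      refine hacc_g.trans ?_
      rw [sq]
      gcongr
    have h_sum := norm_sum_smul_le_sqrt_card (W (G (gbar - g))) Hc hL hHc
    rw [Fintype.card_fin] at h_sum
    rw [h_split]
    calc _ ≤ ‖∑ i, (W (G (gbar - g))) i • Hc i‖ + ‖Hfbar - Hf‖ := norm_sub_le _ _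
      _ ≤ Real.sqrt m * (κ_g * (Δmax * Δ) / Real.sqrt κ₁) * L_G + κ_h * Δ := by
        refine add_le_add (h_sum.trans ?_) hacc_h
        gcongr
      _ = _ := by ring
  have : NeZero (d - m) := ⟨by omega⟩
  exact ⟨h_hess, (abs_negPart_iInf_rayleigh_sub_le hZ₁ _ _).trans h_hess⟩
end
end

section
/- Assume ‖H̄‖ ≤ κ_B, 0 < μ ≤ μ̂, ‖ḡ − g(x)‖ ≤ κ_g·max{1, Δ_max}·Δ, and ‖s‖ ≤ Δ ≤ Δ_max with x, x+s ∈ Ω. Then |L_μ(x+s) − L_μ(x) − Pred| ≤ Υ₁·Δ², where Υ₁ = κ_g·max{1, Δ_max} + (1/2)·(L_{∇f} + κ_B + μ̂·L_G). -/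
open scoped RealInnerProductSpace NNReal

noncomputable section

/-- First-order Taylor estimate: if the derivative of `F` is `K`-Lipschitz on a convex set, the
linearization error over a step `s` inside that set is at most `K / 2 * ‖s‖ ^ 2`. -/
theorem norm_image_add_sub_sub_le_of_lipschitzOnWith_fderiv {E F : Type*}
    [NormedAddCommGroup E] [NormedSpace ℝ E] [NormedAddCommGroup F] [NormedSpace ℝ F]
    {U : Set E} (hU : Convex ℝ U) {φ : E → F} {φ' : E → E →L[ℝ] F} {K : ℝ≥0}
    (hφ : ∀ y ∈ U, HasFDerivAt φ (φ' y) y) (hlip : LipschitzOnWith K φ' U)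
    {x s : E} (hx : x ∈ U) (hxs : x + s ∈ U) :
    ‖φ (x + s) - φ x - φ' x s‖ ≤ K / 2 * ‖s‖ ^ 2 := by
  have hmem : ∀ t ∈ Set.Icc (0 : ℝ) 1, x + t • s ∈ U := fun t ht =>
    hU.add_smul_mem hx hxs ht
  have hderiv : ∀ t ∈ Set.Icc (0 : ℝ) 1,
      HasDerivAt (fun t : ℝ => φ (x + t • s) - φ x - t • φ' x s)
        (φ' (x + t • s) s - φ' x s) t := by
    intro t ht
    have hline : HasDerivAt (fun t : ℝ => x + t • s) s t := by
      simpa using ((hasDerivAt_id t).smul_const s).const_add x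
    have hlin : HasDerivAt (fun t : ℝ => t • φ' x s) (φ' x s) t := by
      simpa using (hasDerivAt_id t).smul_const (φ' x s)
    exact (((hφ _ (hmem t ht)).comp_hasDerivAt t hline).sub_const _).sub hlin
  have hbound : ∀ t ∈ Set.Ico (0 : ℝ) 1,
      ‖φ' (x + t • s) s - φ' x s‖ ≤ K * ‖s‖ ^ 2 * t := by
    intro t ht
    have hnorm := hlip.norm_sub_le (hmem t ⟨ht.1, ht.2.le⟩) hx
    rw [add_sub_cancel_left, norm_smul, Real.norm_of_nonneg ht.1] at hnorm
    calc ‖φ' (x + t • s) s - φ' x s‖ ≤ ‖φ' (x + t • s) - φ' x‖ * ‖s‖ := by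
          rw [← sub_apply]
          exact ContinuousLinearMap.le_opNorm _ _
      _ ≤ K * (t * ‖s‖) * ‖s‖ := by gcongr
      _ = K * ‖s‖ ^ 2 * t := by ring
  have hquad : ∀ t : ℝ, HasDerivAt (fun t => K / 2 * ‖s‖ ^ 2 * t ^ 2) (K * ‖s‖ ^ 2 * t) t := by
    intro t
    exact ((hasDerivAt_pow 2 t).const_mul ((K : ℝ) / 2 * ‖s‖ ^ 2)).congr_deriv (by
      push_cast
      ring)
  simpa using image_norm_le_of_norm_deriv_right_le_deriv_boundary
    (fun t ht => (hderiv t ht).continuousAt.continuousWithinAt)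
    (fun t ht => (hderiv t ⟨ht.1, ht.2.le⟩).hasDerivWithinAt) (by simp) hquad hbound
    (Set.right_mem_Icc.mpr zero_le_one)

/-- difference between the actual merit-function reduction and the predicted
reduction, without the second-order correction step (Lemma 4 of the paper).
`f` has gradient `g` (L_{∇f}-Lipschitz on the open convex set `Ω`), `c` has Jacobian `G`
(L_G-Lipschitz on `Ω`), `L_μ(y) = f(y) + μ‖c(y)‖`, and
`Pred = ḡᵀs + (1/2)sᵀH̄s + μ(‖c(x) + G(x)s‖ − ‖c(x)‖)`. -/
theorem stmt_4 {d m : ℕ}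
    (Ω : Set (EuclideanSpace ℝ (Fin d))) (hΩopen : IsOpen Ω) (hΩconv : Convex ℝ Ω)
    (f : EuclideanSpace ℝ (Fin d) → ℝ)
    (g : EuclideanSpace ℝ (Fin d) → EuclideanSpace ℝ (Fin d))
    (c : EuclideanSpace ℝ (Fin d) → EuclideanSpace ℝ (Fin m))
    (G : EuclideanSpace ℝ (Fin d) → (EuclideanSpace ℝ (Fin d) →L[ℝ] EuclideanSpace ℝ (Fin m)))
    (L_gradf L_G : ℝ≥0)
    (hgrad : ∀ y ∈ Ω, HasGradientAt f (g y) y)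
    (hglip : LipschitzOnWith L_gradf g Ω)
    (hjac : ∀ y ∈ Ω, HasFDerivAt c (G y) y)
    (hGlip : LipschitzOnWith L_G G Ω)
    (x s gbar : EuclideanSpace ℝ (Fin d))
    (H : EuclideanSpace ℝ (Fin d) →L[ℝ] EuclideanSpace ℝ (Fin d))
    (κ_B μ μhat κ_g Δ Δmax : ℝ)
    (hx : x ∈ Ω) (hxs : x + s ∈ Ω)
    (hH : ‖H‖ ≤ κ_B)
    (hμ0 : 0 < μ) (hμ : μ ≤ μhat)
    (hgacc : ‖gbar - g x‖ ≤ κ_g * max 1 Δmax * Δ)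
    (hs : ‖s‖ ≤ Δ) (hΔ : Δ ≤ Δmax) :
    |(f (x + s) + μ * ‖c (x + s)‖) - (f x + μ * ‖c x‖) -
        (⟪gbar, s⟫ + 1 / 2 * ⟪s, H s⟫ + μ * (‖c x + G x s‖ - ‖c x‖))| ≤
      (κ_g * max 1 Δmax + 1 / 2 * ((L_gradf : ℝ) + κ_B + μhat * (L_G : ℝ))) * Δ ^ 2 := by
  have hΔ0 : 0 ≤ Δ := (norm_nonneg s).trans hs
  have hμhat : 0 ≤ μhat := hμ0.le.trans hμ
  have hsq : ‖s‖ ^ 2 ≤ Δ ^ 2 := by gcongr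
  have hf : |f (x + s) - f x - ⟪g x, s⟫| ≤ L_gradf / 2 * Δ ^ 2 := by
    have hdual : LipschitzOnWith L_gradf
        (fun y => InnerProductSpace.toDual ℝ (EuclideanSpace ℝ (Fin d)) (g y)) Ω :=
      LipschitzOnWith.of_dist_le_mul fun y hy z hz => by
        simpa only [LinearIsometryEquiv.dist_map] using hglip.dist_le_mul y hy z hz
    have htaylor := norm_image_add_sub_sub_le_of_lipschitzOnWith_fderiv hΩconv
      (fun y hy => (hgrad y hy).hasFDerivAt) hdual hx hxs
    rw [InnerProductSpace.toDual_apply_apply, Real.norm_eq_abs] at htaylor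
    exact htaylor.trans (by gcongr)
  have hc : |μ * (‖c (x + s)‖ - ‖c x + G x s‖)| ≤ μhat * (L_G / 2 * Δ ^ 2) := by
    have htaylor := norm_image_add_sub_sub_le_of_lipschitzOnWith_fderiv hΩconv hjac hGlip hx hxs
    rw [sub_sub] at htaylor
    rw [abs_mul, abs_of_pos hμ0]
    have := (abs_norm_sub_norm_le (c (x + s)) (c x + G x s)).trans
      (htaylor.trans (by gcongr : (L_G : ℝ) / 2 * ‖s‖ ^ 2 ≤ L_G / 2 * Δ ^ 2))
    gcongr
  have hg : |⟪gbar - g x, s⟫| ≤ κ_g * max 1 Δmax * Δ * Δ :=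
    (abs_real_inner_le_norm _ _).trans
      (mul_le_mul hgacc hs (norm_nonneg _) ((norm_nonneg _).trans hgacc))
  have hquad : |⟪s, H s⟫| ≤ κ_B * Δ ^ 2 := by
    have hHs : ‖H s‖ ≤ κ_B * Δ :=
      (H.le_opNorm s).trans (mul_le_mul hH hs (norm_nonneg _) ((norm_nonneg _).trans hH))
    calc |⟪s, H s⟫| ≤ ‖s‖ * ‖H s‖ := abs_real_inner_le_norm _ _
      _ ≤ Δ * (κ_B * Δ) := mul_le_mul hs hHs (norm_nonneg _) hΔ0
      _ = κ_B * Δ ^ 2 := by ring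
  rw [inner_sub_left] at hg
  rw [abs_le] at *
  constructor <;> linarith [hf.1, hf.2, hc.1, hc.2, hg.1, hg.2, hquad.1, hquad.2]
end
end

section
/- Suppose G(x)·G(x)ᵀ ⪰ κ₁·I with κ₁ > 0, and let ‖s‖ ≤ Δ with x, x+s ∈ Ω. Then the second-order correction step d = −G(x)ᵀ·(G(x)·G(x)ᵀ)⁻¹·(c(x+s) − c(x) − G(x)s) satisfies ‖d‖ ≤ (L_G/√κ₁)·Δ². -/
open scoped RealInnerProductSpace NNReal
open ContinuousLinearMap

noncomputable section

/-- First-order Taylor estimate along a segment for a map whose derivative is Lipschitz. -/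
theorem norm_taylor_remainder_le_of_lipschitzOnWith {E F : Type*}
    [NormedAddCommGroup E] [NormedSpace ℝ E] [NormedAddCommGroup F] [NormedSpace ℝ F]
    {s : Set E} (hs : Convex ℝ s) {f : E → F} {f' : E → E →L[ℝ] F} {K : ℝ≥0}
    (hf : ∀ y ∈ s, HasFDerivAt f (f' y) y) (hK : LipschitzOnWith K f' s)
    {x h : E} (hx : x ∈ s) (hxh : x + h ∈ s) :
    ‖f (x + h) - f x - f' x h‖ ≤ K * ‖h‖ ^ 2 := by
  have hsub : segment ℝ x (x + h) ⊆ s := hs.segment_subset hx hxh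
  have hbound : ∀ y ∈ segment ℝ x (x + h), ‖f' y - f' x‖ ≤ K * ‖h‖ := by
    intro y hy
    have hyx : ‖y - x‖ ≤ ‖h‖ := by simpa using norm_sub_le_of_mem_segment hy
    exact (hK.norm_sub_le (hsub hy) hx).trans (by gcongr)
  have key := (convex_segment x (x + h)).norm_image_sub_le_of_norm_hasFDerivWithin_le'
    (fun y hy => (hf y (hsub hy)).hasFDerivWithinAt) hbound
    (left_mem_segment ℝ x (x + h)) (right_mem_segment ℝ x (x + h))
  rw [add_sub_cancel_left] at key
  exact key.trans_eq (by ring)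

/-- If `A A† ≥ κ`, then `√κ ‖A† w‖ ≤ ‖A A† w‖`. -/
theorem sqrt_mul_norm_adjoint_apply_le {E F : Type*}
    [NormedAddCommGroup E] [InnerProductSpace ℝ E] [CompleteSpace E]
    [NormedAddCommGroup F] [InnerProductSpace ℝ F] [CompleteSpace F]
    (A : E →L[ℝ] F) {κ : ℝ} (w : F) (hA : κ * ‖w‖ ^ 2 ≤ ⟪A (adjoint A w), w⟫) :
    √κ * ‖adjoint A w‖ ≤ ‖A (adjoint A w)‖ := by
  have hsq : ⟪A (adjoint A w), w⟫ = ‖adjoint A w‖ ^ 2 := by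
    rw [← adjoint_inner_right, real_inner_self_eq_norm_sq]
  have hw : √κ * ‖w‖ ≤ ‖adjoint A w‖ := by
    rw [← Real.sqrt_sq (norm_nonneg w), ← Real.sqrt_mul' κ (sq_nonneg _)]
    exact Real.sqrt_le_iff.mpr ⟨norm_nonneg _, hA.trans_eq hsq⟩
  have hcs : ‖adjoint A w‖ ^ 2 ≤ ‖A (adjoint A w)‖ * ‖w‖ :=
    hsq ▸ real_inner_le_norm _ _
  rcases (norm_nonneg (adjoint A w)).eq_or_lt with h0 | hpos
  · rw [← h0, mul_zero]
    exact norm_nonneg _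
  · refine le_of_mul_le_mul_right ?_ hpos
    calc √κ * ‖adjoint A w‖ * ‖adjoint A w‖ = √κ * ‖adjoint A w‖ ^ 2 := by ring
      _ ≤ √κ * (‖A (adjoint A w)‖ * ‖w‖) := by gcongr
      _ = ‖A (adjoint A w)‖ * (√κ * ‖w‖) := by ring
      _ ≤ ‖A (adjoint A w)‖ * ‖adjoint A w‖ := by gcongr

/-- length of the second-order correction step.  `c` has Jacobian `G`
(L_G-Lipschitz on the open convex set `Ω`), `G(x)·G(x)ᵀ ⪰ κ₁·I` (here `Gᵀ` is the adjoint and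
`W` plays the role of `(G(x)·G(x)ᵀ)⁻¹`), and the SOC step
`d = −G(x)ᵀ·(G(x)·G(x)ᵀ)⁻¹·(c(x+s) − c(x) − G(x)s)` satisfies `‖d‖ ≤ (L_G/√κ₁)·Δ²`. -/
theorem stmt_5 {d m : ℕ}
    (Ω : Set (EuclideanSpace ℝ (Fin d))) (hΩopen : IsOpen Ω) (hΩconv : Convex ℝ Ω)
    (c : EuclideanSpace ℝ (Fin d) → EuclideanSpace ℝ (Fin m))
    (G : EuclideanSpace ℝ (Fin d) → (EuclideanSpace ℝ (Fin d) →L[ℝ] EuclideanSpace ℝ (Fin m)))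
    (L_G : ℝ≥0)
    (hjac : ∀ y ∈ Ω, HasFDerivAt c (G y) y)
    (hGlip : LipschitzOnWith L_G G Ω)
    (κ₁ Δ : ℝ) (hκ₁ : 0 < κ₁)
    (x s : EuclideanSpace ℝ (Fin d))
    (hx : x ∈ Ω) (hxs : x + s ∈ Ω) (hs : ‖s‖ ≤ Δ)
    (hGpos : ∀ v : EuclideanSpace ℝ (Fin m), κ₁ * ‖v‖ ^ 2 ≤ ⟪G x (adjoint (G x) v), v⟫)
    (W : EuclideanSpace ℝ (Fin m) →L[ℝ] EuclideanSpace ℝ (Fin m))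
    (hW₁ : ∀ v, W (G x (adjoint (G x) v)) = v)
    (hW₂ : ∀ v, G x (adjoint (G x) (W v)) = v) :
    ‖-(adjoint (G x)) (W (c (x + s) - c x - G x s))‖ ≤ (L_G : ℝ) / Real.sqrt κ₁ * Δ ^ 2 := by
  have hr := norm_taylor_remainder_le_of_lipschitzOnWith hΩconv hjac hGlip hx hxs
  have hd := sqrt_mul_norm_adjoint_apply_le (G x) _ (hGpos (W (c (x + s) - c x - G x s)))
  rw [hW₂] at hd
  rw [norm_neg, div_mul_eq_mul_div, le_div_iff₀' (Real.sqrt_pos.mpr hκ₁)]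
  exact hd.trans (hr.trans (by gcongr))
end
end

section
/- Suppose G(x)·G(x)ᵀ ⪰ κ₁·I with κ₁ > 0, let ‖s‖ ≤ Δ ≤ Δ_max, let d = −G(x)ᵀ·(G(x)·G(x)ᵀ)⁻¹·(c(x+s) − c(x) − G(x)s) be the second-order correction step, and assume x, x+s, x+s+d ∈ Ω. Then ‖c(x+s+d) − c(x) − G(x)s‖ ≤ (√m·L_G²/√κ₁ + √m·L_G³·Δ_max/κ₁)·Δ³. -/
open scoped RealInnerProductSpace NNReal
open ContinuousLinearMap

noncomputable section

/-- If the derivative `G` of `c` is `K`-Lipschitz on a convex set, then linearizing `c` at `a` gives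
the increment between two points within distance `R` of `a` up to `K * R` times their distance. -/
theorem norm_sub_sub_le_of_lipschitzOnWith_fderiv {E F : Type*}
    [NormedAddCommGroup E] [NormedSpace ℝ E] [NormedAddCommGroup F] [NormedSpace ℝ F]
    {Ω : Set E} (hΩ : Convex ℝ Ω) {c : E → F} {G : E → E →L[ℝ] F} {K : ℝ≥0}
    (hc : ∀ y ∈ Ω, HasFDerivAt c (G y) y) (hG : LipschitzOnWith K G Ω)
    {a y z : E} {R : ℝ} (ha : a ∈ Ω) (hy : y ∈ Ω) (hz : z ∈ Ω)
    (hya : ‖y - a‖ ≤ R) (hza : ‖z - a‖ ≤ R) :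
    ‖c z - c y - G a (z - y)‖ ≤ K * R * ‖z - y‖ := by
  refine (hΩ.inter (convex_closedBall a R)).norm_image_sub_le_of_norm_hasFDerivWithin_le'
    (f' := G) (fun w hw => (hc w hw.1).hasFDerivWithinAt) (fun w hw => ?_)
    ⟨hy, mem_closedBall_iff_norm.2 hya⟩ ⟨hz, mem_closedBall_iff_norm.2 hza⟩
  exact (hG.norm_sub_le hw.1 ha).trans
    (mul_le_mul_of_nonneg_left (mem_closedBall_iff_norm.1 hw.2) K.2)

/-- If `A A* ⪰ κ I`, then `‖A* u‖ ≤ ‖A A* u‖ / √κ`. -/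
theorem norm_adjoint_apply_le_div_sqrt {E F : Type*}
    [NormedAddCommGroup E] [InnerProductSpace ℝ E] [CompleteSpace E]
    [NormedAddCommGroup F] [InnerProductSpace ℝ F] [CompleteSpace F]
    (A : E →L[ℝ] F) {κ : ℝ} (hκ : 0 < κ) (hA : ∀ v, κ * ‖v‖ ^ 2 ≤ ⟪A (adjoint A v), v⟫) (u : F) :
    ‖adjoint A u‖ ≤ ‖A (adjoint A u)‖ / √κ := by
  have hsq : ‖adjoint A u‖ ^ 2 = ⟪A (adjoint A u), u⟫ := by
    rw [← adjoint_inner_right, real_inner_self_eq_norm_sq]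
  have hcs := real_inner_le_norm (A (adjoint A u)) u
  have hu : κ * ‖u‖ ≤ ‖A (adjoint A u)‖ := by
    rcases (norm_nonneg u).eq_or_lt with h | h
    · simp [← h]
    · refine le_of_mul_le_mul_right ?_ h
      linarith [hA u]
  rw [le_div_iff₀ (Real.sqrt_pos.2 hκ)]
  refine (sq_le_sq₀ (by positivity) (norm_nonneg _)).1 ?_
  rw [mul_pow, Real.sq_sqrt hκ.le]
  nlinarith [norm_nonneg (A (adjoint A u))]

/-- after the second-order correction step
`d = −G(x)ᵀ·(G(x)·G(x)ᵀ)⁻¹·(c(x+s) − c(x) − G(x)s)` (with `Gᵀ` the adjoint and `W` playing the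
role of `(G(x)·G(x)ᵀ)⁻¹`), the linearization error of the constraints at the corrected trial
point is of order `Δ³`. -/
theorem stmt_6 {d m : ℕ}
    (Ω : Set (EuclideanSpace ℝ (Fin d))) (hΩopen : IsOpen Ω) (hΩconv : Convex ℝ Ω)
    (c : EuclideanSpace ℝ (Fin d) → EuclideanSpace ℝ (Fin m))
    (G : EuclideanSpace ℝ (Fin d) → (EuclideanSpace ℝ (Fin d) →L[ℝ] EuclideanSpace ℝ (Fin m)))
    (L_G : ℝ≥0)
    (hjac : ∀ y ∈ Ω, HasFDerivAt c (G y) y)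
    (hGlip : LipschitzOnWith L_G G Ω)
    (κ₁ Δ Δmax : ℝ) (hκ₁ : 0 < κ₁)
    (x s : EuclideanSpace ℝ (Fin d))
    (hx : x ∈ Ω) (hxs : x + s ∈ Ω) (hs : ‖s‖ ≤ Δ) (hΔ : Δ ≤ Δmax)
    (hGpos : ∀ v : EuclideanSpace ℝ (Fin m), κ₁ * ‖v‖ ^ 2 ≤ ⟪G x (adjoint (G x) v), v⟫)
    (W : EuclideanSpace ℝ (Fin m) →L[ℝ] EuclideanSpace ℝ (Fin m))
    (hW₁ : ∀ v, W (G x (adjoint (G x) v)) = v)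
    (hW₂ : ∀ v, G x (adjoint (G x) (W v)) = v)
    (hxsd : x + s + (-(adjoint (G x)) (W (c (x + s) - c x - G x s))) ∈ Ω) :
    ‖c (x + s + (-(adjoint (G x)) (W (c (x + s) - c x - G x s)))) - c x - G x s‖ ≤
      (Real.sqrt m * (L_G : ℝ) ^ 2 / Real.sqrt κ₁ +
        Real.sqrt m * (L_G : ℝ) ^ 3 * Δmax / κ₁) * Δ ^ 3 := by
  rcases Nat.eq_zero_or_pos m with rfl | hm
  · simp [Subsingleton.elim (_ : EuclideanSpace ℝ (Fin 0)) 0]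
  set r := c (x + s) - c x - G x s with hr
  set p := -(adjoint (G x)) (W r) with hp
  have hΔ₀ : 0 ≤ Δ := (norm_nonneg s).trans hs
  have hκ : 0 < √κ₁ := Real.sqrt_pos.2 hκ₁
  have hr_le : ‖r‖ ≤ L_G * Δ ^ 2 := by
    have h := norm_sub_sub_le_of_lipschitzOnWith_fderiv hΩconv hjac hGlip (R := Δ) hx hx hxs
      (by simpa using hΔ₀) (by simpa using hs)
    rw [add_sub_cancel_left] at h
    calc ‖r‖ ≤ L_G * Δ * ‖s‖ := h
      _ ≤ L_G * Δ * Δ := by gcongr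
      _ = L_G * Δ ^ 2 := by ring
  have hp_le : ‖p‖ ≤ L_G * Δ ^ 2 / √κ₁ := by
    have h := norm_adjoint_apply_le_div_sqrt (G x) hκ₁ hGpos (W r)
    rw [hW₂] at h
    rw [hp, norm_neg]
    exact h.trans (by gcongr)
  have hGp : G x p = -r := by rw [hp, map_neg, hW₂]
  have hmain := norm_sub_sub_le_of_lipschitzOnWith_fderiv hΩconv hjac hGlip (R := Δ + ‖p‖)
    hx hxs hxsd (by simpa using hs.trans (le_add_of_nonneg_right (norm_nonneg p)))
    (by
      rw [add_assoc, add_sub_cancel_left]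
      exact (norm_add_le s p).trans (by gcongr))
  rw [add_sub_cancel_left, hGp] at hmain
  have herr : c (x + s + p) - c x - G x s = c (x + s + p) - c (x + s) - -r := by
    rw [hr]; abel
  have hsqrt_m : 1 ≤ √(m : ℝ) := Real.one_le_sqrt.2 (by exact_mod_cast hm)
  calc ‖c (x + s + p) - c x - G x s‖ ≤ L_G * (Δ + ‖p‖) * ‖p‖ := by rwa [herr]
    _ ≤ L_G * (Δ + L_G * Δ ^ 2 / √κ₁) * (L_G * Δ ^ 2 / √κ₁) := by gcongr
    _ = (L_G ^ 2 / √κ₁ + L_G ^ 3 * Δ / √κ₁ ^ 2) * Δ ^ 3 := by field_simp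
    _ = 1 * (L_G ^ 2 / √κ₁ + L_G ^ 3 * Δ / κ₁) * Δ ^ 3 := by rw [Real.sq_sqrt hκ₁.le, one_mul]
    _ ≤ √m * (L_G ^ 2 / √κ₁ + L_G ^ 3 * Δmax / κ₁) * Δ ^ 3 := by gcongr
    _ = (√m * L_G ^ 2 / √κ₁ + √m * L_G ^ 3 * Δmax / κ₁) * Δ ^ 3 := by ring
end
end

section
/- Under the stated hypotheses, the merit-function difference after the second-order correction step satisfies |L_μ(x+s+d) − L_μ(x) − Pred| ≤ Υ₂·Δ³, where Υ₂ = κ_g + (L_{∇²f} + κ_h)/2 + L_G²·Δ_max·(0.5·L_{∇f} + √m·μ̂·L_G)/κ₁ + (0.5·√m·L_{∇²c}·(L_{∇f}·Δ_max + κ_{∇f}) + 0.5·√m·L_G·(κ_g·Δ_max + L_{∇f} + 2·μ̂·L_G))/√κ₁. -/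
open scoped RealInnerProductSpace NNReal
open ContinuousLinearMap

noncomputable section

/-- First-order Taylor estimate for a map with Lipschitz derivative on a convex set. -/
theorem norm_taylor_one_le {E F : Type*} [NormedAddCommGroup E] [NormedSpace ℝ E]
    [NormedAddCommGroup F] [NormedSpace ℝ F] {S : Set E} (hS : Convex ℝ S)
    {φ : E → F} {φ' : E → E →L[ℝ] F} {L : ℝ≥0}
    (hφ : ∀ y ∈ S, HasFDerivAt φ (φ' y) y) (hL : LipschitzOnWith L φ' S)
    {x h : E} (hx : x ∈ S) (hxh : x + h ∈ S) :
    ‖φ (x + h) - φ x - φ' x h‖ ≤ L / 2 * ‖h‖ ^ 2 := by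
  have hmem : ∀ t ∈ Set.Icc (0 : ℝ) 1, x + t • h ∈ S := fun t ht => by
    simpa using hS.add_smul_sub_mem hx hxh ht
  have hline : ∀ t : ℝ, HasDerivAt (fun t : ℝ => x + t • h) h t := fun t => by
    simpa using ((hasDerivAt_id t).smul_const h).const_add x
  have hder : ∀ t ∈ Set.Icc (0 : ℝ) 1,
      HasDerivAt (fun t : ℝ => φ (x + t • h) - φ x - t • φ' x h)
        (φ' (x + t • h) h - φ' x h) t := fun t ht => by
    have h1 := ((hφ _ (hmem t ht)).comp_hasDerivAt t (hline t)).sub_const (φ x)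
    refine (h1.sub ((hasDerivAt_id t).smul_const (φ' x h))).congr_deriv ?_
    simp
  have hB : ∀ t : ℝ, HasDerivAt (fun t : ℝ => L * ‖h‖ ^ 2 / 2 * t ^ 2) (L * ‖h‖ ^ 2 * t) t :=
    fun t => by
      refine ((hasDerivAt_pow 2 t).const_mul (L * ‖h‖ ^ 2 / 2 : ℝ)).congr_deriv ?_
      push_cast
      ring
  have key := image_norm_le_of_norm_deriv_right_le_deriv_boundary
    (f := fun t : ℝ => φ (x + t • h) - φ x - t • φ' x h)
    (fun t ht => (hder t ht).continuousAt.continuousWithinAt)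
    (fun t ht => (hder t (Set.Ico_subset_Icc_self ht)).hasDerivWithinAt)
    (by simp) hB (fun t ht => by
      have ht' := Set.Ico_subset_Icc_self ht
      have hlip := hL.dist_le_mul _ (hmem t ht') _ hx
      rw [dist_eq_norm, dist_eq_norm, add_sub_cancel_left, norm_smul, Real.norm_of_nonneg ht.1]
        at hlip
      calc ‖φ' (x + t • h) h - φ' x h‖ = ‖(φ' (x + t • h) - φ' x) h‖ := by simp
        _ ≤ ‖φ' (x + t • h) - φ' x‖ * ‖h‖ := ContinuousLinearMap.le_opNorm _ _
        _ ≤ (L * (t * ‖h‖)) * ‖h‖ := by gcongr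
        _ = L * ‖h‖ ^ 2 * t := by ring)
    (Set.right_mem_Icc.2 zero_le_one)
  simp only [one_smul, one_pow, mul_one] at key
  linarith

section Gradient

variable {E : Type*} [NormedAddCommGroup E] [InnerProductSpace ℝ E] [CompleteSpace E]

/-- First-order Taylor estimate for a function with Lipschitz gradient on a convex set. -/
theorem abs_taylor_one_le {S : Set E} (hS : Convex ℝ S) {φ : E → ℝ} {g : E → E} {L : ℝ≥0}
    (hφ : ∀ y ∈ S, HasGradientAt φ (g y) y) (hL : LipschitzOnWith L g S)
    {x h : E} (hx : x ∈ S) (hxh : x + h ∈ S) :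
    |φ (x + h) - φ x - ⟪g x, h⟫| ≤ L / 2 * ‖h‖ ^ 2 := by
  have hL' : LipschitzOnWith L (fun y => InnerProductSpace.toDual ℝ E (g y)) S :=
    ((InnerProductSpace.toDual ℝ E).lipschitz.comp_lipschitzOnWith hL).weaken (one_mul L).le
  simpa using norm_taylor_one_le hS (fun y hy => (hφ y hy).hasFDerivAt) hL' hx hxh

/-- Second-order Taylor estimate for a function with Lipschitz Hessian on a convex set. -/
theorem abs_taylor_two_le {S : Set E} (hS : Convex ℝ S) {φ : E → ℝ} {g : E → E}
    {H : E → E →L[ℝ] E} {L : ℝ≥0}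
    (hφ : ∀ y ∈ S, HasGradientAt φ (g y) y) (hg : ∀ y ∈ S, HasFDerivAt g (H y) y)
    (hL : LipschitzOnWith L H S) {x h : E} (hx : x ∈ S) (hxh : x + h ∈ S) :
    |φ (x + h) - φ x - ⟪g x, h⟫ - 1 / 2 * ⟪h, H x h⟫| ≤ L / 2 * ‖h‖ ^ 3 := by
  have hmem : ∀ t ∈ Set.Icc (0 : ℝ) 1, x + t • h ∈ S := fun t ht => by
    simpa using hS.add_smul_sub_mem hx hxh ht
  have hline : ∀ t : ℝ, HasDerivAt (fun t : ℝ => x + t • h) h t := fun t => by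
    simpa using ((hasDerivAt_id t).smul_const h).const_add x
  have hder : ∀ t ∈ Set.Icc (0 : ℝ) 1,
      HasDerivAt (fun t : ℝ => φ (x + t • h) - t * ⟪g x, h⟫ - t ^ 2 * (1 / 2 * ⟪h, H x h⟫))
        ⟪g (x + t • h) - g x - H x (t • h), h⟫ t := fun t ht => by
    have h1 := (hφ _ (hmem t ht)).hasFDerivAt.comp_hasDerivAt t (hline t)
    refine ((h1.sub ((hasDerivAt_id t).mul_const ⟪g x, h⟫)).sub
      ((hasDerivAt_pow 2 t).mul_const (1 / 2 * ⟪h, H x h⟫))).congr_deriv ?_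
    simp only [InnerProductSpace.toDual_apply_apply, inner_sub_left, map_smul, inner_smul_left,
      real_inner_comm h (H x h)]
    simp
    ring
  have key := norm_image_sub_le_of_norm_deriv_le_segment_01'
    (f := fun t : ℝ => φ (x + t • h) - t * ⟪g x, h⟫ - t ^ 2 * (1 / 2 * ⟪h, H x h⟫))
    (C := L / 2 * ‖h‖ ^ 3) (fun t ht => (hder t ht).hasDerivWithinAt) (fun t ht => by
      have ht' := Set.Ico_subset_Icc_self ht
      have hth : ‖t • h‖ ≤ ‖h‖ := by
        rw [norm_smul, Real.norm_of_nonneg ht.1]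
        exact mul_le_of_le_one_left (norm_nonneg _) ht.2.le
      calc ‖⟪g (x + t • h) - g x - H x (t • h), h⟫‖
          ≤ ‖g (x + t • h) - g x - H x (t • h)‖ * ‖h‖ := norm_inner_le_norm _ _
        _ ≤ (L / 2 * ‖t • h‖ ^ 2) * ‖h‖ := by
            gcongr
            exact norm_taylor_one_le hS hg hL hx (hmem t ht')
        _ ≤ (L / 2 * ‖h‖ ^ 2) * ‖h‖ := by gcongr
        _ = L / 2 * ‖h‖ ^ 3 := by ring)
  simp only [Real.norm_eq_abs, one_smul, zero_smul, add_zero, one_mul, one_pow, zero_mul, sub_zero,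
    ne_eq, OfNat.ofNat_ne_zero, not_false_eq_true, zero_pow] at key
  convert key using 2
  ring

variable {F : Type*} [NormedAddCommGroup F] [InnerProductSpace ℝ F] [CompleteSpace F]

/-- The pseudo-inverse `Aᵀ(AAᵀ)⁻¹` has norm at most `1 / √κ` when `AAᵀ ⪰ κ·I`. -/
theorem norm_adjoint_inverse_le {A : E →L[ℝ] F} {W : F →L[ℝ] F} {κ : ℝ} (hκ : 0 < κ)
    (hA : ∀ v : F, κ * ‖v‖ ^ 2 ≤ ⟪A (adjoint A v), v⟫)
    (hW : ∀ v, A (adjoint A (W v)) = v) (v : F) :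
    ‖adjoint A (W v)‖ ≤ ‖v‖ / √κ := by
  have hsq : ‖adjoint A (W v)‖ ^ 2 = ⟪v, W v⟫ := by
    rw [← real_inner_self_eq_norm_sq, adjoint_inner_right, hW]
  have hinner : ⟪v, W v⟫ ≤ ‖v‖ * ‖W v‖ := real_inner_le_norm _ _
  have hlow : κ * ‖W v‖ ^ 2 ≤ ⟪v, W v⟫ := by simpa [hW] using hA (W v)
  have hWv : κ * ‖W v‖ ≤ ‖v‖ := by
    rcases (norm_nonneg (W v)).eq_or_lt with h0 | h0
    · rw [← h0, mul_zero]
      exact norm_nonneg v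
    · exact le_of_mul_le_mul_right (by nlinarith) h0
  refine le_of_sq_le_sq ?_ (by positivity)
  rw [div_pow, Real.sq_sqrt hκ.le, hsq, le_div_iff₀ hκ]
  nlinarith [norm_nonneg v]

/-- A right inverse of `AAᵀ` is symmetric. -/
theorem inner_inverse_comm {A : E →L[ℝ] F} {W : F →L[ℝ] F}
    (hW : ∀ v, A (adjoint A (W v)) = v) (u v : F) : ⟪W u, v⟫ = ⟪u, W v⟫ := by
  calc ⟪W u, v⟫ = ⟪W u, A (adjoint A (W v))⟫ := by rw [hW]
    _ = ⟪adjoint A (W u), adjoint A (W v)⟫ := (adjoint_inner_left _ _ _).symm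
    _ = ⟪A (adjoint A (W u)), W v⟫ := adjoint_inner_right _ _ _
    _ = ⟪u, W v⟫ := by rw [hW]

end Gradient

/-- A vector whose coordinates are bounded by `B` has Euclidean norm at most `√m * B`. -/
theorem EuclideanSpace.norm_le_sqrt_mul {m : ℕ} {v : EuclideanSpace ℝ (Fin m)} {B : ℝ}
    (hB : 0 ≤ B) (hv : ∀ i, |v i| ≤ B) : ‖v‖ ≤ √m * B := by
  refine le_of_sq_le_sq ?_ (by positivity)
  rw [EuclideanSpace.real_norm_sq_eq, mul_pow, Real.sq_sqrt (Nat.cast_nonneg m)]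
  calc ∑ i, v i ^ 2 ≤ ∑ _i : Fin m, B ^ 2 :=
        Finset.sum_le_sum fun i _ => sq_le_sq' (abs_le.1 (hv i)).1 (abs_le.1 (hv i)).2
    _ = m * B ^ 2 := by simp

/-- difference between the actual merit-function reduction and the predicted
reduction when the second-order correction step is performed (Lemma 5 of the paper).
`f` has gradient `g` and Hessian `Hf` (the derivative of `g`), `c` has Jacobian `G` and
constraint Hessians `Hc i` (the derivative of `y ↦ ∇cⁱ(y) = G(y)ᵀeᵢ`), `Gᵀ` is the adjoint,
`W` plays the role of `(G(x)·G(x)ᵀ)⁻¹`, the SOC step is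
`d = −G(x)ᵀ·(G(x)G(x)ᵀ)⁻¹·(c(x+s) − c(x) − G(x)s)`, the multiplier estimate is
`λ̄ = −(G(x)G(x)ᵀ)⁻¹G(x)ḡ`, `H̄ = ∇̄²f + Σᵢ λ̄ⁱ·∇²cⁱ(x)`, `L_μ(y) = f(y) + μ‖c(y)‖`, and
`Pred = ḡᵀs + (1/2)sᵀH̄s + μ(‖c(x) + G(x)s‖ − ‖c(x)‖)`. -/
theorem stmt_7 {d m : ℕ}
    (Ω : Set (EuclideanSpace ℝ (Fin d))) (hΩopen : IsOpen Ω) (hΩconv : Convex ℝ Ω)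
    (f : EuclideanSpace ℝ (Fin d) → ℝ)
    (g : EuclideanSpace ℝ (Fin d) → EuclideanSpace ℝ (Fin d))
    (Hf : EuclideanSpace ℝ (Fin d) → (EuclideanSpace ℝ (Fin d) →L[ℝ] EuclideanSpace ℝ (Fin d)))
    (c : EuclideanSpace ℝ (Fin d) → EuclideanSpace ℝ (Fin m))
    (G : EuclideanSpace ℝ (Fin d) → (EuclideanSpace ℝ (Fin d) →L[ℝ] EuclideanSpace ℝ (Fin m)))
    (Hc : Fin m → EuclideanSpace ℝ (Fin d) →
      (EuclideanSpace ℝ (Fin d) →L[ℝ] EuclideanSpace ℝ (Fin d)))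
    (L_gradf L_hessf L_G L_hessc : ℝ≥0)
    (κ_gradf κ_g κ_h κ₁ μ μhat Δ Δmax : ℝ)
    (x s gbar : EuclideanSpace ℝ (Fin d))
    (Hfbar : EuclideanSpace ℝ (Fin d) →L[ℝ] EuclideanSpace ℝ (Fin d))
    (W : EuclideanSpace ℝ (Fin m) →L[ℝ] EuclideanSpace ℝ (Fin m))
    -- smoothness of the objective
    (hgrad : ∀ y ∈ Ω, HasGradientAt f (g y) y)
    (hhess : ∀ y ∈ Ω, HasFDerivAt g (Hf y) y)
    (hglip : LipschitzOnWith L_gradf g Ω)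
    (hHfbound : ∀ y ∈ Ω, ‖Hf y‖ ≤ (L_gradf : ℝ))
    (hHflip : LipschitzOnWith L_hessf Hf Ω)
    (hgx : ‖g x‖ ≤ κ_gradf)
    -- smoothness of the constraints
    (hjac : ∀ y ∈ Ω, HasFDerivAt c (G y) y)
    (hGlip : LipschitzOnWith L_G G Ω)
    (hhessc : ∀ i, ∀ y ∈ Ω,
      HasFDerivAt (fun z => adjoint (G z) (EuclideanSpace.single i 1)) (Hc i y) y)
    (hHclip : ∀ i, LipschitzOnWith L_hessc (Hc i) Ω)
    (hHcx : ∀ i, ‖Hc i x‖ ≤ (L_G : ℝ))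
    -- constraint qualification at x
    (hκ₁ : 0 < κ₁)
    (hGpos : ∀ v : EuclideanSpace ℝ (Fin m), κ₁ * ‖v‖ ^ 2 ≤ ⟪G x (adjoint (G x) v), v⟫)
    (hW₁ : ∀ v, W (G x (adjoint (G x) v)) = v)
    (hW₂ : ∀ v, G x (adjoint (G x) (W v)) = v)
    -- the step, the SOC step, and the radius
    (hx : x ∈ Ω) (hs : ‖s‖ ≤ Δ) (hΔ : Δ ≤ Δmax)
    (hxs : x + s ∈ Ω)
    (hxsd : x + s + (-(adjoint (G x)) (W (c (x + s) - c x - G x s))) ∈ Ω)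
    -- accuracy of the random estimates
    (hκg : 0 < κ_g) (hκh : 0 < κ_h)
    (hgacc : ‖gbar - g x‖ ≤ κ_g * Δ ^ 2)
    (hHfbarsym : IsSelfAdjoint Hfbar)
    (hHfacc : ‖Hfbar - Hf x‖ ≤ κ_h * Δ)
    -- merit parameter
    (hμ0 : 0 < μ) (hμ : μ ≤ μhat) :
    |(f (x + s + (-(adjoint (G x)) (W (c (x + s) - c x - G x s)))) +
          μ * ‖c (x + s + (-(adjoint (G x)) (W (c (x + s) - c x - G x s))))‖) -
        (f x + μ * ‖c x‖) -
        (⟪gbar, s⟫ +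
          1 / 2 * ⟪s, (Hfbar + ∑ i, (-(W (G x gbar))) i • Hc i x) s⟫ +
          μ * (‖c x + G x s‖ - ‖c x‖))| ≤
      (κ_g + ((L_hessf : ℝ) + κ_h) / 2 +
        (L_G : ℝ) ^ 2 * Δmax * (0.5 * (L_gradf : ℝ) + Real.sqrt m * μhat * (L_G : ℝ)) / κ₁ +
        (0.5 * Real.sqrt m * (L_hessc : ℝ) * ((L_gradf : ℝ) * Δmax + κ_gradf) +
          0.5 * Real.sqrt m * (L_G : ℝ) *
            (κ_g * Δmax + (L_gradf : ℝ) + 2 * μhat * (L_G : ℝ))) / Real.sqrt κ₁) * Δ ^ 3 := by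
  set r := c (x + s) - c x - G x s with hr
  set step := -(adjoint (G x)) (W r) with hstep
  set q : EuclideanSpace ℝ (Fin m) := WithLp.toLp 2 fun i => ⟪s, Hc i x s⟫ with hq
  have hΔ0 : 0 ≤ Δ := (norm_nonneg s).trans hs
  have hkk : (√κ₁)⁻¹ ^ 2 = κ₁⁻¹ := by rw [inv_pow, Real.sq_sqrt hκ₁.le]
  have hP := norm_adjoint_inverse_le hκ₁ hGpos hW₂
  have hr1 : ‖r‖ ≤ L_G / 2 * Δ ^ 2 :=
    (norm_taylor_one_le hΩconv hjac hGlip hx hxs).trans (by gcongr)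
  have hr2 : ‖r‖ ≤ √m * (L_G / 2 * Δ ^ 2) :=
    EuclideanSpace.norm_le_sqrt_mul (by positivity) fun i =>
      (PiLp.norm_apply_le r i).trans hr1
  have hd1 : ‖step‖ ≤ L_G / 2 * Δ ^ 2 / √κ₁ := by
    rw [hstep, norm_neg]
    exact (hP r).trans (by gcongr)
  have hd2 : ‖step‖ ≤ √m * (L_G / 2 * Δ ^ 2) / √κ₁ := by
    rw [hstep, norm_neg]
    exact (hP r).trans (by gcongr)
  have hci : ∀ i, ∀ y ∈ Ω, HasGradientAt (fun z => c z i)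
      (adjoint (G y) (EuclideanSpace.single i 1)) y := fun i y hy => by
    rw [hasGradientAt_iff_hasFDerivAt]
    refine ((EuclideanSpace.proj i : EuclideanSpace ℝ (Fin m) →L[ℝ] ℝ).hasFDerivAt.comp y
      (hjac y hy)).congr_fderiv ?_
    ext v
    simp [adjoint_inner_left, EuclideanSpace.inner_single_left]
  have hrq : ‖r - (1 / 2 : ℝ) • q‖ ≤ √m * (L_hessc / 2 * Δ ^ 3) := by
    refine EuclideanSpace.norm_le_sqrt_mul (by positivity) fun i => ?_
    have h := abs_taylor_two_le hΩconv (hci i) (hhessc i) (hHclip i) hx hxs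
    rw [adjoint_inner_left, EuclideanSpace.inner_single_left] at h
    refine le_trans (le_of_eq ?_) (h.trans (by gcongr : _ ≤ (L_hessc : ℝ) / 2 * Δ ^ 3))
    simp [hr, hq]
  have hq2 : ‖(1 / 2 : ℝ) • q‖ ≤ √m * (L_G / 2 * Δ ^ 2) := by
    refine EuclideanSpace.norm_le_sqrt_mul (by positivity) fun i => ?_
    have h : |⟪s, Hc i x s⟫| ≤ Δ * (L_G * Δ) :=
      (abs_real_inner_le_norm _ _).trans (mul_le_mul hs
        (((Hc i x).le_opNorm s).trans (mul_le_mul (hHcx i) hs (norm_nonneg _) (by positivity)))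
        (norm_nonneg _) hΔ0)
    simp only [hq, PiLp.smul_apply, smul_eq_mul, abs_mul]
    rw [abs_of_pos (by norm_num : (0 : ℝ) < 1 / 2)]
    linarith
  have hlag : ⟪s, (∑ i, (-(W (G x gbar))) i • Hc i x) s⟫ = -⟪gbar, adjoint (G x) (W q)⟫ := by
    rw [adjoint_inner_right, ← inner_inverse_comm hW₂, ← inner_neg_left,
      PiLp.inner_apply (-(W (G x gbar)))]
    simp only [sum_apply, inner_sum, smul_apply,
      inner_smul_right, hq]
    exact Finset.sum_congr rfl fun i _ => by simp [mul_comm]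
  have hg1 : ‖g (x + s) - g x‖ ≤ L_gradf * Δ := by
    have h := hglip.dist_le_mul _ hxs _ hx
    rw [dist_eq_norm, dist_eq_norm, add_sub_cancel_left] at h
    exact h.trans (by gcongr)
  have hg2 : ‖g (x + s)‖ ≤ L_gradf * Δmax + κ_gradf := by
    have h1 : ‖g (x + s)‖ ≤ ‖g (x + s) - g x‖ + ‖g x‖ := by
      simpa using norm_add_le (g (x + s) - g x) (g x)
    have h2 : (L_gradf : ℝ) * Δ ≤ L_gradf * Δmax := by gcongr
    linarith
  have hg3 : ‖g (x + s) - gbar‖ ≤ (κ_g * Δmax + L_gradf) * Δ := by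
    have h1 : ‖g (x + s) - gbar‖ ≤ ‖g (x + s) - g x‖ + ‖gbar - g x‖ := by
      rw [norm_sub_rev gbar]
      exact norm_sub_le_norm_sub_add_norm_sub _ _ _
    have h2 : κ_g * Δ ^ 2 ≤ κ_g * Δmax * Δ := by
      rw [mul_assoc, sq]
      gcongr
    linarith
  have hT1 : |⟪gbar - g x, s⟫| ≤ κ_g * Δ ^ 3 :=
    (abs_real_inner_le_norm _ _).trans <|
      (mul_le_mul hgacc hs (norm_nonneg _) (by positivity)).trans_eq (by ring)
  have hT2 : |f (x + s) - f x - ⟪g x, s⟫ - 1 / 2 * ⟪s, Hf x s⟫| ≤ L_hessf / 2 * Δ ^ 3 :=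
    (abs_taylor_two_le hΩconv hgrad hhess hHflip hx hxs).trans (by gcongr)
  have hT3 : |⟪s, (Hfbar - Hf x) s⟫| ≤ κ_h * Δ ^ 3 :=
    (abs_real_inner_le_norm _ _).trans <|
      (mul_le_mul hs (((Hfbar - Hf x).le_opNorm s).trans
        (mul_le_mul hHfacc hs (norm_nonneg _) (by positivity))) (norm_nonneg _) hΔ0).trans_eq
          (by ring)
  have hT4 : |f (x + s + step) - f (x + s) - ⟪g (x + s), step⟫| ≤
      L_G ^ 2 * Δmax * (0.5 * L_gradf) / κ₁ * Δ ^ 3 := by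
    refine (abs_taylor_one_le hΩconv hgrad hglip hxs hxsd).trans ?_
    calc (L_gradf : ℝ) / 2 * ‖step‖ ^ 2
        ≤ L_gradf / 2 * (L_G / 2 * Δ ^ 2 / √κ₁) ^ 2 := by gcongr
      _ = 1 / 4 * (L_G ^ 2 * Δ * (0.5 * L_gradf) / κ₁ * Δ ^ 3) := by
        linear_combination L_gradf * L_G ^ 2 * Δ ^ 4 / 8 * hkk
      _ ≤ 1 * (L_G ^ 2 * Δmax * (0.5 * L_gradf) / κ₁ * Δ ^ 3) := by
        gcongr
        norm_num
      _ = _ := one_mul _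
  have hT5 : |⟪g (x + s), adjoint (G x) (W (r - (1 / 2 : ℝ) • q))⟫| ≤
      0.5 * √m * L_hessc * (L_gradf * Δmax + κ_gradf) / √κ₁ * Δ ^ 3 := by
    have h0 := (norm_nonneg _).trans hg2
    calc _ ≤ ‖g (x + s)‖ * ‖adjoint (G x) (W (r - (1 / 2 : ℝ) • q))‖ :=
          abs_real_inner_le_norm _ _
      _ ≤ (L_gradf * Δmax + κ_gradf) * (√m * (L_hessc / 2 * Δ ^ 3) / √κ₁) := by
        refine mul_le_mul hg2 ((hP _).trans ?_) (norm_nonneg _) h0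
        gcongr
      _ = _ := by ring
  have hT6 : |⟪g (x + s) - gbar, adjoint (G x) (W ((1 / 2 : ℝ) • q))⟫| ≤
      0.5 * √m * L_G * (κ_g * Δmax + L_gradf) / √κ₁ * Δ ^ 3 := by
    have h0 := (norm_nonneg _).trans hg3
    calc _ ≤ ‖g (x + s) - gbar‖ * ‖adjoint (G x) (W ((1 / 2 : ℝ) • q))‖ :=
          abs_real_inner_le_norm _ _
      _ ≤ ((κ_g * Δmax + L_gradf) * Δ) * (√m * (L_G / 2 * Δ ^ 2) / √κ₁) := by
        refine mul_le_mul hg3 ((hP _).trans ?_) (norm_nonneg _) h0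
        gcongr
      _ = _ := by ring
  have hfeas : c (x + s + step) - (c x + G x s) =
      (c (x + s + step) - c (x + s) - G (x + s) step) + (G (x + s) - G x) step := by
    have h : G x step = -r := by rw [hstep, map_neg, hW₂]
    rw [sub_apply, h, hr]
    abel
  have hGG : ‖(G (x + s) - G x) step‖ ≤ L_G * Δ * (√m * (L_G / 2 * Δ ^ 2) / √κ₁) := by
    have h := hGlip.dist_le_mul _ hxs _ hx
    rw [dist_eq_norm, dist_eq_norm, add_sub_cancel_left] at h
    refine ((G (x + s) - G x).le_opNorm step).trans
      (mul_le_mul (h.trans ?_) hd2 (norm_nonneg _) (by positivity))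
    gcongr
  have hTc : ‖c (x + s + step) - c (x + s) - G (x + s) step‖ ≤
      L_G / 2 * ((L_G / 2 * Δ ^ 2 / √κ₁) * (√m * (L_G / 2 * Δ ^ 2) / √κ₁)) := by
    refine (norm_taylor_one_le hΩconv hjac hGlip hxs hxsd).trans ?_
    rw [sq]
    gcongr
  have hT7 : |μ * (‖c (x + s + step)‖ - ‖c x + G x s‖)| ≤
      0.5 * √m * L_G * (2 * μhat * L_G) / √κ₁ * Δ ^ 3 +
        L_G ^ 2 * Δmax * (√m * μhat * L_G) / κ₁ * Δ ^ 3 := by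
    have hμhat : 0 ≤ μhat := hμ0.le.trans hμ
    have h1 : |‖c (x + s + step)‖ - ‖c x + G x s‖| ≤
        L_G / 2 * ((L_G / 2 * Δ ^ 2 / √κ₁) * (√m * (L_G / 2 * Δ ^ 2) / √κ₁)) +
          L_G * Δ * (√m * (L_G / 2 * Δ ^ 2) / √κ₁) := by
      refine (abs_norm_sub_norm_le _ _).trans ?_
      rw [hfeas]
      exact (norm_add_le _ _).trans (add_le_add hTc hGG)
    rw [abs_mul, abs_of_pos hμ0]
    calc _ ≤ μhat * (L_G / 2 * ((L_G / 2 * Δ ^ 2 / √κ₁) * (√m * (L_G / 2 * Δ ^ 2) / √κ₁)) +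
          L_G * Δ * (√m * (L_G / 2 * Δ ^ 2) / √κ₁)) :=
        mul_le_mul hμ h1 (abs_nonneg _) hμhat
      _ = 1 / 2 * (0.5 * √m * L_G * (2 * μhat * L_G) / √κ₁ * Δ ^ 3) +
          1 / 8 * (L_G ^ 2 * Δ * (√m * μhat * L_G) / κ₁ * Δ ^ 3) := by
        linear_combination μhat * L_G ^ 3 * Δ ^ 4 * √m / 8 * hkk
      _ ≤ 1 * (0.5 * √m * L_G * (2 * μhat * L_G) / √κ₁ * Δ ^ 3) +
          1 * (L_G ^ 2 * Δmax * (√m * μhat * L_G) / κ₁ * Δ ^ 3) := by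
        gcongr <;> norm_num
      _ = _ := by rw [one_mul, one_mul]
  have hsplit : (f (x + s + step) + μ * ‖c (x + s + step)‖) - (f x + μ * ‖c x‖) -
      (⟪gbar, s⟫ + 1 / 2 * ⟪s, (Hfbar + ∑ i, (-(W (G x gbar))) i • Hc i x) s⟫ +
        μ * (‖c x + G x s‖ - ‖c x‖)) =
      (f (x + s) - f x - ⟪g x, s⟫ - 1 / 2 * ⟪s, Hf x s⟫) - ⟪gbar - g x, s⟫ -
        1 / 2 * ⟪s, (Hfbar - Hf x) s⟫ +
        (f (x + s + step) - f (x + s) - ⟪g (x + s), step⟫) -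
        ⟪g (x + s), adjoint (G x) (W (r - (1 / 2 : ℝ) • q))⟫ -
        ⟪g (x + s) - gbar, adjoint (G x) (W ((1 / 2 : ℝ) • q))⟫ +
        μ * (‖c (x + s + step)‖ - ‖c x + G x s‖) := by
    rw [add_apply, inner_add_right, hlag, hstep]
    simp only [map_sub, map_smul, sub_apply, inner_sub_left, inner_sub_right,
      inner_smul_right, inner_neg_right]
    ring
  have hbound : (κ_g + ((L_hessf : ℝ) + κ_h) / 2 +
        (L_G : ℝ) ^ 2 * Δmax * (0.5 * (L_gradf : ℝ) + √m * μhat * (L_G : ℝ)) / κ₁ +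
        (0.5 * √m * (L_hessc : ℝ) * ((L_gradf : ℝ) * Δmax + κ_gradf) +
          0.5 * √m * (L_G : ℝ) *
            (κ_g * Δmax + (L_gradf : ℝ) + 2 * μhat * (L_G : ℝ))) / √κ₁) * Δ ^ 3 =
      L_hessf / 2 * Δ ^ 3 + κ_g * Δ ^ 3 + 1 / 2 * (κ_h * Δ ^ 3) +
        L_G ^ 2 * Δmax * (0.5 * L_gradf) / κ₁ * Δ ^ 3 +
        0.5 * √m * L_hessc * (L_gradf * Δmax + κ_gradf) / √κ₁ * Δ ^ 3 +
        0.5 * √m * L_G * (κ_g * Δmax + L_gradf) / √κ₁ * Δ ^ 3 +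
        (0.5 * √m * L_G * (2 * μhat * L_G) / √κ₁ * Δ ^ 3 +
          L_G ^ 2 * Δmax * (√m * μhat * L_G) / κ₁ * Δ ^ 3) := by
    ring
  rw [hsplit, hbound]
  rw [abs_le] at *
  constructor <;> linarith
end
end

section
/- Suppose ‖∇L‖ ≥ (max{κ_B, (4·κ_f·max{1, Δ_max} + 8·Υ₁)/(κ_fcd·(1−η))} + κ_g·max{1, Δ_max})·Δ. Then Pred < 0, Ared ≤ η·Pred (equivalently Ared/Pred ≥ η), and moreover L_μ(x+s) − L_μ(x) ≤ −Υ₃·‖∇L‖·Δ, where Υ₃ = (3·κ_fcd/8)·max{ κ_B/(κ_g·max{1,Δ_max} + κ_B), (4·κ_f·max{1,Δ_max} + 8·Υ₁)/(((1−η)·κ_fcd·κ_g + 4·κ_f)·max{1,Δ_max} + 8·Υ₁) }. -/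
open scoped RealInnerProductSpace NNReal
open ContinuousLinearMap
open scoped Classical

noncomputable section

section Auxiliary

/-- First-order Taylor estimate for a map whose derivative is Lipschitz on a convex set. -/
theorem norm_taylor_sub_le_of_lipschitzOnWith {E F : Type*}
    [NormedAddCommGroup E] [NormedSpace ℝ E] [NormedAddCommGroup F] [NormedSpace ℝ F]
    {Ω : Set E} (hΩ : Convex ℝ Ω) {c : E → F} {G : E → E →L[ℝ] F} {K : ℝ≥0}
    (hc : ∀ y ∈ Ω, HasFDerivAt c (G y) y) (hG : LipschitzOnWith K G Ω)
    {x s : E} (hx : x ∈ Ω) (hxs : x + s ∈ Ω) :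
    ‖c (x + s) - c x - G x s‖ ≤ K / 2 * ‖s‖ ^ 2 := by
  have hmem : ∀ t ∈ Set.Icc (0 : ℝ) 1, x + t • s ∈ Ω := fun t ht =>
    hΩ.add_smul_mem hx hxs ht
  have hderiv : ∀ t ∈ Set.Icc (0 : ℝ) 1,
      HasDerivAt (fun t : ℝ => c (x + t • s) - c x - t • G x s) (G (x + t • s) s - G x s) t := by
    intro t ht
    have hline : HasDerivAt (fun t : ℝ => x + t • s) s t := by
      simpa using ((hasDerivAt_id t).smul_const s).const_add x
    have hlin : HasDerivAt (fun t : ℝ => t • G x s) (G x s) t := by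
      simpa using (hasDerivAt_id t).smul_const (G x s)
    exact (((hc _ (hmem t ht)).comp_hasDerivAt t hline).sub_const (c x)).sub hlin
  have hB : ∀ t : ℝ, HasDerivAt (fun t : ℝ => K / 2 * ‖s‖ ^ 2 * t ^ 2) (K * ‖s‖ ^ 2 * t) t := by
    intro t
    refine ((hasDerivAt_pow 2 t).const_mul (K / 2 * ‖s‖ ^ 2 : ℝ)).congr_deriv ?_
    push_cast
    ring
  have hbound : ∀ t ∈ Set.Ico (0 : ℝ) 1, ‖G (x + t • s) s - G x s‖ ≤ K * ‖s‖ ^ 2 * t := by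
    intro t ht
    have hlip := hG.norm_sub_le (hmem t (Set.Ico_subset_Icc_self ht)) hx
    rw [add_sub_cancel_left, norm_smul, Real.norm_of_nonneg ht.1] at hlip
    calc ‖G (x + t • s) s - G x s‖ = ‖(G (x + t • s) - G x) s‖ := by simp
      _ ≤ ‖G (x + t • s) - G x‖ * ‖s‖ := ContinuousLinearMap.le_opNorm _ _
      _ ≤ K * (t * ‖s‖) * ‖s‖ := by gcongr
      _ = K * ‖s‖ ^ 2 * t := by ring
  have h := image_norm_le_of_norm_deriv_right_le_deriv_boundary
    (fun t ht => (hderiv t ht).continuousAt.continuousWithinAt)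
    (fun t ht => (hderiv t (Set.Ico_subset_Icc_self ht)).hasDerivWithinAt)
    (by simp) hB hbound (Set.right_mem_Icc.2 zero_le_one)
  simpa using h

/-- First-order Taylor estimate for a function whose gradient is Lipschitz on a convex set. -/
theorem abs_taylor_sub_le_of_lipschitzOnWith_gradient {E : Type*}
    [NormedAddCommGroup E] [InnerProductSpace ℝ E] [CompleteSpace E]
    {Ω : Set E} (hΩ : Convex ℝ Ω) {f : E → ℝ} {g : E → E} {K : ℝ≥0}
    (hf : ∀ y ∈ Ω, HasGradientAt f (g y) y) (hg : LipschitzOnWith K g Ω)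
    {x s : E} (hx : x ∈ Ω) (hxs : x + s ∈ Ω) :
    |f (x + s) - f x - ⟪g x, s⟫| ≤ K / 2 * ‖s‖ ^ 2 := by
  have hlip : LipschitzOnWith K (fun y => InnerProductSpace.toDual ℝ E (g y)) Ω := by
    have h := (InnerProductSpace.toDual ℝ E).lipschitz.comp_lipschitzOnWith hg
    rw [one_mul] at h
    exact h
  simpa using norm_taylor_sub_le_of_lipschitzOnWith hΩ
    (fun y hy => (hf y hy).hasFDerivAt) hlip hx hxs

/-- The orthogonal projection onto the kernel of `A`, written through a right inverse `W` of
`A A*`, does not increase norms. -/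
theorem norm_sub_adjoint_apply_le {E F : Type*}
    [NormedAddCommGroup E] [InnerProductSpace ℝ E] [CompleteSpace E]
    [NormedAddCommGroup F] [InnerProductSpace ℝ F] [CompleteSpace F]
    (A : E →L[ℝ] F) (W : F →L[ℝ] F) (hW : ∀ v, A (adjoint A (W v)) = v) (u : E) :
    ‖u - adjoint A (W (A u))‖ ≤ ‖u‖ := by
  have horth : ⟪u - adjoint A (W (A u)), adjoint A (W (A u))⟫ = 0 := by
    rw [adjoint_inner_right, map_sub, hW, sub_self, inner_zero_left]
  have h := norm_add_sq_eq_norm_sq_add_norm_sq_of_inner_eq_zero _ _ horth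
  rw [sub_add_cancel] at h
  nlinarith [norm_nonneg u, norm_nonneg (u - adjoint A (W (A u))),
    mul_self_nonneg ‖adjoint A (W (A u))‖]

theorem sqrt_sq_add_sq_le_add {a b c e : ℝ} (ha : 0 ≤ a) (he : 0 ≤ e) (h : a ≤ b + e) :
    √(a ^ 2 + c ^ 2) ≤ √(b ^ 2 + c ^ 2) + e := by
  have hb : b ≤ √(b ^ 2 + c ^ 2) := Real.le_sqrt_of_sq_le (by nlinarith [sq_nonneg c])
  have hsq := Real.sq_sqrt (by positivity : 0 ≤ b ^ 2 + c ^ 2)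
  refine Real.sqrt_le_iff.2 ⟨by positivity, ?_⟩
  nlinarith [mul_le_mul_of_nonneg_left hb he, pow_le_pow_left₀ ha h 2]

/-- If `N` exceeds `(C + k) Δ`, then subtracting `k Δ` keeps at least the fraction `C / (k + C)`. -/
theorem div_add_mul_le_of_add_mul_le {C k Δ N N' : ℝ} (hC : 0 < C) (hk : 0 ≤ k)
    (hN : (C + k) * Δ ≤ N) (hN' : N ≤ N' + k * Δ) : C / (k + C) * N ≤ N' := by
  rw [div_mul_eq_mul_div, div_le_iff₀ (by positivity)]
  nlinarith [mul_le_mul_of_nonneg_left hN hk,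
    mul_le_mul_of_nonneg_left hN' (by positivity : 0 ≤ k + C)]

end Auxiliary

/-- a sufficiently large true KKT residual forces a successful iteration and a
merit-function reduction proportional to `‖∇L‖·Δ` (Lemma 6 of the paper).  Here `Gᵀ` is the
adjoint, `W` plays the role of `(G(x)·G(x)ᵀ)⁻¹`, `P(x)·u = u − G(x)ᵀ·W·G(x)·u`, the KKT
residual vectors are `∇L = (P(x)g(x), c(x))` and `∇̄L = (P(x)ḡ, c(x))` with Euclidean norm
`√(‖·‖² + ‖·‖²)`, and `‖∇̄L‖/‖H̄‖` is interpreted as `+∞` when `H̄ = 0`. -/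
theorem stmt_8 {d m : ℕ}
    (Ω : Set (EuclideanSpace ℝ (Fin d))) (hΩopen : IsOpen Ω) (hΩconv : Convex ℝ Ω)
    (f : EuclideanSpace ℝ (Fin d) → ℝ)
    (g : EuclideanSpace ℝ (Fin d) → EuclideanSpace ℝ (Fin d))
    (c : EuclideanSpace ℝ (Fin d) → EuclideanSpace ℝ (Fin m))
    (G : EuclideanSpace ℝ (Fin d) → (EuclideanSpace ℝ (Fin d) →L[ℝ] EuclideanSpace ℝ (Fin m)))
    (L_gradf L_G : ℝ≥0)
    (hgrad : ∀ y ∈ Ω, HasGradientAt f (g y) y)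
    (hglip : LipschitzOnWith L_gradf g Ω)
    (hjac : ∀ y ∈ Ω, HasFDerivAt c (G y) y)
    (hGlip : LipschitzOnWith L_G G Ω)
    (η κ_fcd κ_g κ_f κ_B Δmax μhat μ Δ κ₁ : ℝ)
    (hη0 : 0 < η) (hη1 : η < 1) (hκfcd0 : 0 < κ_fcd) (hκfcd1 : κ_fcd ≤ 1)
    (hκg : 0 < κ_g) (hκf : 0 < κ_f) (hκB : 1 ≤ κ_B)
    (hΔmax : 0 < Δmax) (hμhat : 0 < μhat) (hκ₁ : 0 < κ₁)
    (x s gbar : EuclideanSpace ℝ (Fin d))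
    (H : EuclideanSpace ℝ (Fin d) →L[ℝ] EuclideanSpace ℝ (Fin d))
    (hx : x ∈ Ω) (hxs : x + s ∈ Ω)
    (hs : ‖s‖ ≤ Δ) (hΔ0 : 0 < Δ) (hΔ : Δ ≤ Δmax)
    (hgacc : ‖gbar - g x‖ ≤ κ_g * max 1 Δmax * Δ)
    (hH : ‖H‖ ≤ κ_B)
    (hμ0 : 0 < μ) (hμ : μ ≤ μhat)
    (hGpos : ∀ v : EuclideanSpace ℝ (Fin m), κ₁ * ‖v‖ ^ 2 ≤ ⟪G x (adjoint (G x) v), v⟫)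
    (W : EuclideanSpace ℝ (Fin m) →L[ℝ] EuclideanSpace ℝ (Fin m))
    (hW₁ : ∀ v, W (G x (adjoint (G x) v)) = v)
    (hW₂ : ∀ v, G x (adjoint (G x) (W v)) = v)
    (hPred : ⟪gbar, s⟫ + 1 / 2 * ⟪s, H s⟫ + μ * (‖c x + G x s‖ - ‖c x‖) ≤
      -(κ_fcd / 2) * Real.sqrt (‖gbar - (adjoint (G x)) (W (G x gbar))‖ ^ 2 + ‖c x‖ ^ 2) *
        (if H = 0 then Δ else
          min Δ (Real.sqrt (‖gbar - (adjoint (G x)) (W (G x gbar))‖ ^ 2 + ‖c x‖ ^ 2) / ‖H‖)))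
    (fbar_k fbar_s : ℝ)
    (hfk : |fbar_k - f x| ≤ κ_f * max 1 Δmax * Δ ^ 2)
    (hfs : |fbar_s - f (x + s)| ≤ κ_f * max 1 Δmax * Δ ^ 2)
    (hbig : (max κ_B ((4 * κ_f * max 1 Δmax +
          8 * (κ_g * max 1 Δmax + 1 / 2 * ((L_gradf : ℝ) + κ_B + μhat * (L_G : ℝ)))) /
            (κ_fcd * (1 - η))) + κ_g * max 1 Δmax) * Δ ≤
      Real.sqrt (‖g x - (adjoint (G x)) (W (G x (g x)))‖ ^ 2 + ‖c x‖ ^ 2)) :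
    (⟪gbar, s⟫ + 1 / 2 * ⟪s, H s⟫ + μ * (‖c x + G x s‖ - ‖c x‖) < 0) ∧
    (fbar_s - fbar_k + μ * (‖c (x + s)‖ - ‖c x‖) ≤
      η * (⟪gbar, s⟫ + 1 / 2 * ⟪s, H s⟫ + μ * (‖c x + G x s‖ - ‖c x‖))) ∧
    ((f (x + s) + μ * ‖c (x + s)‖) - (f x + μ * ‖c x‖) ≤
      -(3 * κ_fcd / 8 *
          max (κ_B / (κ_g * max 1 Δmax + κ_B))
            ((4 * κ_f * max 1 Δmax +
                8 * (κ_g * max 1 Δmax + 1 / 2 * ((L_gradf : ℝ) + κ_B + μhat * (L_G : ℝ)))) /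
              (((1 - η) * κ_fcd * κ_g + 4 * κ_f) * max 1 Δmax +
                8 * (κ_g * max 1 Δmax + 1 / 2 * ((L_gradf : ℝ) + κ_B + μhat * (L_G : ℝ)))))) *
        Real.sqrt (‖g x - (adjoint (G x)) (W (G x (g x)))‖ ^ 2 + ‖c x‖ ^ 2) * Δ) := by
  set M := max 1 Δmax
  have hM : 0 < M := lt_max_of_lt_left one_pos
  set Υ : ℝ := κ_g * M + 1 / 2 * ((L_gradf : ℝ) + κ_B + μhat * (L_G : ℝ)) with hΥ
  have hΥ0 : 0 < Υ := by positivity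
  set N := √(‖g x - (adjoint (G x)) (W (G x (g x)))‖ ^ 2 + ‖c x‖ ^ 2)
  set N' := √(‖gbar - (adjoint (G x)) (W (G x gbar))‖ ^ 2 + ‖c x‖ ^ 2)
  set Pred : ℝ := ⟪gbar, s⟫ + 1 / 2 * ⟪s, H s⟫ + μ * (‖c x + G x s‖ - ‖c x‖) with hPred_def
  have hη : 0 < 1 - η := sub_pos.2 hη1
  set A := (4 * κ_f * M + 8 * Υ) / (κ_fcd * (1 - η)) with hA
  have hA0 : 0 < A := by positivity
  have hk : 0 ≤ κ_g * M := by positivity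
  have hNN' : N ≤ N' + κ_g * M * Δ := by
    refine sqrt_sq_add_sq_le_add (norm_nonneg _) (by positivity) ?_
    have hproj := (norm_sub_adjoint_apply_le (G x) W hW₂ (g x - gbar)).trans
      ((norm_sub_rev _ _).trans_le hgacc)
    have heq : g x - (adjoint (G x)) (W (G x (g x))) =
        (gbar - (adjoint (G x)) (W (G x gbar))) +
          ((g x - gbar) - (adjoint (G x)) (W (G x (g x - gbar)))) := by
      simp only [map_sub]
      abel
    rw [heq]
    exact (norm_add_le _ _).trans (by gcongr)
  have hmax : max κ_B A * Δ ≤ N' := by linarith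
  have hBN' : κ_B * Δ ≤ N' := le_trans (by gcongr; exact le_max_left _ _) hmax
  have hAN' : A * Δ ≤ N' := le_trans (by gcongr; exact le_max_right _ _) hmax
  have hN'0 : 0 < N' := lt_of_lt_of_le (by positivity) hAN'
  have hstep : (if H = 0 then Δ else min Δ (N' / ‖H‖)) = Δ := by
    split_ifs with hH0
    · rfl
    · refine min_eq_left ((le_div_iff₀ (norm_pos_iff.2 hH0)).2 (le_trans ?_ hBN'))
      rw [mul_comm]
      gcongr
  rw [hstep] at hPred
  have hPred_neg : Pred < 0 := by
    have : 0 < κ_fcd / 2 * N' * Δ := by positivity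
    linarith
  have hmodel : (f (x + s) + μ * ‖c (x + s)‖) - (f x + μ * ‖c x‖) ≤ Pred + Υ * Δ ^ 2 := by
    have hs2 : ‖s‖ ^ 2 ≤ Δ ^ 2 := by gcongr
    have hf1 : f (x + s) - f x - ⟪g x, s⟫ ≤ L_gradf / 2 * Δ ^ 2 :=
      (le_abs_self _).trans
        ((abs_taylor_sub_le_of_lipschitzOnWith_gradient hΩconv hgrad hglip hx hxs).trans
          (by gcongr))
    have hc1 : μ * (‖c (x + s)‖ - ‖c x + G x s‖) ≤ μhat * (L_G / 2 * Δ ^ 2) := by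
      have h1 : ‖c (x + s)‖ - ‖c x + G x s‖ ≤ L_G / 2 * Δ ^ 2 := by
        refine (norm_sub_norm_le _ _).trans ?_
        rw [← sub_sub]
        exact (norm_taylor_sub_le_of_lipschitzOnWith hΩconv hjac hGlip hx hxs).trans (by gcongr)
      exact (mul_le_mul_of_nonneg_left h1 hμ0.le).trans (by gcongr)
    have hg1 : -⟪gbar - g x, s⟫ ≤ κ_g * M * Δ * Δ :=
      (neg_le_abs _).trans ((abs_real_inner_le_norm _ _).trans (by gcongr))
    have hH1 : -⟪s, H s⟫ ≤ Δ * (κ_B * Δ) :=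
      (neg_le_abs _).trans ((abs_real_inner_le_norm _ _).trans
        (by gcongr; exact H.le_of_opNorm_le_of_le hH hs))
    rw [inner_sub_left] at hg1
    rw [hPred_def, hΥ]
    linarith
  have hΥA : A * (κ_fcd * (1 - η)) = 4 * κ_f * M + 8 * Υ := by
    rw [hA]
    field_simp
  have hAcc : (4 * κ_f * M + 8 * Υ) * Δ ^ 2 ≤ κ_fcd * (1 - η) * N' * Δ := by
    have := mul_le_mul_of_nonneg_left hAN' (by positivity : 0 ≤ κ_fcd * (1 - η) * Δ)
    rw [← hΥA]
    linarith
  refine ⟨hPred_neg, ?_, ?_⟩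
  · have hk1 := (abs_le.1 hfk).1
    have hs1 := (abs_le.1 hfs).2
    have hP := mul_le_mul_of_nonneg_left hPred hη.le
    have hΥΔ : 0 ≤ Υ * Δ ^ 2 := by positivity
    linarith
  · have hloss : 8 * Υ * Δ ^ 2 ≤ κ_fcd * N' * Δ := by
      have h1 : 0 ≤ 4 * κ_f * M * Δ ^ 2 := by positivity
      have h2 : 0 ≤ η * (κ_fcd * N' * Δ) := by positivity
      linarith
    have hfrac : max (κ_B / (κ_g * M + κ_B))
        ((4 * κ_f * M + 8 * Υ) / (((1 - η) * κ_fcd * κ_g + 4 * κ_f) * M + 8 * Υ)) * N ≤ N' := by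
      have hB : (κ_B + κ_g * M) * Δ ≤ N := le_trans (by gcongr; exact le_max_left _ _) hbig
      have hAN : (A + κ_g * M) * Δ ≤ N := le_trans (by gcongr; exact le_max_right _ _) hbig
      have hAfrac : (4 * κ_f * M + 8 * Υ) / (((1 - η) * κ_fcd * κ_g + 4 * κ_f) * M + 8 * Υ) =
          A / (κ_g * M + A) := by
        rw [← hΥA, div_eq_div_iff (by positivity) (by positivity)]
        linear_combination A * hΥA
      rw [hAfrac, max_mul_of_nonneg _ _ (Real.sqrt_nonneg _)]
      exact max_le (div_add_mul_le_of_add_mul_le (by positivity) hk hB hNN')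
        (div_add_mul_le_of_add_mul_le hA0 hk hAN hNN')
    have := mul_le_mul_of_nonneg_left hfrac (by positivity : 0 ≤ 3 * κ_fcd / 8 * Δ)
    linarith
end
end

section
/- Suppose ‖c(x)‖ ≥ r, Pred ≤ −(κ_fcd/2)·τ̄⁺·‖c(x)‖·Δ, τ̄⁺ > 0, and (1−η)·κ_fcd·r·τ̄⁺ ≥ (4·κ_f·Δ_max + 2·Υ₁)·Δ. Then Pred < 0 and Ared ≤ η·Pred (equivalently Ared/Pred ≥ η). -/
open scoped RealInnerProductSpace NNReal

noncomputable section

/-- Quadratic remainder bound of the first-order Taylor expansion of a function whose derivative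
is Lipschitz on a convex set. -/
theorem norm_taylor_remainder_le_of_lipschitzOnWith_fderiv
    {E F : Type*} [NormedAddCommGroup E] [NormedSpace ℝ E]
    [NormedAddCommGroup F] [NormedSpace ℝ F] {Ω : Set E} (hΩ : Convex ℝ Ω)
    {c : E → F} {G : E → E →L[ℝ] F} {L : ℝ≥0}
    (hc : ∀ y ∈ Ω, HasFDerivAt c (G y) y) (hG : LipschitzOnWith L G Ω)
    {x s : E} (hx : x ∈ Ω) (hxs : x + s ∈ Ω) :
    ‖c (x + s) - c x - G x s‖ ≤ L / 2 * ‖s‖ ^ 2 := by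
  have hmem : ∀ t ∈ Set.Icc (0 : ℝ) 1, x + t • s ∈ Ω := fun t ht =>
    hΩ.add_smul_mem hx hxs ht
  have hder : ∀ t ∈ Set.Icc (0 : ℝ) 1,
      HasDerivAt (fun t : ℝ => c (x + t • s) - c x - t • G x s) (G (x + t • s) s - G x s) t := by
    intro t ht
    have hline : HasDerivAt (fun t : ℝ => x + t • s) s t := by
      simpa using ((hasDerivAt_id t).smul_const s).const_add x
    have hlin : HasDerivAt (fun t : ℝ => t • G x s) (G x s) t := by
      simpa using (hasDerivAt_id t).smul_const (G x s)
    exact (((hc _ (hmem t ht)).comp_hasDerivAt t hline).sub_const (c x)).sub hlin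
  have hB : ∀ t : ℝ, HasDerivAt (fun t : ℝ => L / 2 * ‖s‖ ^ 2 * t ^ 2) (L * ‖s‖ ^ 2 * t) t := by
    intro t
    refine ((hasDerivAt_pow 2 t).const_mul ((L : ℝ) / 2 * ‖s‖ ^ 2)).congr_deriv ?_
    norm_num
    ring
  have hbound : ∀ t ∈ Set.Ico (0 : ℝ) 1, ‖G (x + t • s) s - G x s‖ ≤ L * ‖s‖ ^ 2 * t := by
    intro t ht
    have hlip := hG.norm_sub_le (hmem t ⟨ht.1, ht.2.le⟩) hx
    rw [add_sub_cancel_left, norm_smul, Real.norm_of_nonneg ht.1] at hlip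
    calc ‖G (x + t • s) s - G x s‖ = ‖(G (x + t • s) - G x) s‖ := rfl
      _ ≤ ‖G (x + t • s) - G x‖ * ‖s‖ := ContinuousLinearMap.le_opNorm _ _
      _ ≤ L * (t * ‖s‖) * ‖s‖ := by gcongr
      _ = L * ‖s‖ ^ 2 * t := by ring
  have key := image_norm_le_of_norm_deriv_right_le_deriv_boundary
    (fun t ht => (hder t ht).continuousAt.continuousWithinAt)
    (fun t ht => (hder t ⟨ht.1, ht.2.le⟩).hasDerivWithinAt)
    (by simp) hB hbound (Set.right_mem_Icc.2 zero_le_one)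
  simpa using key

/-- a sufficiently negative predicted reduction driven by the estimated negative
curvature `τ̄⁺` forces a successful iteration (`Ared/Pred ≥ η`) in the case `‖c(x)‖ ≥ r`, in
which no second-order correction step is performed (part of Lemma 7 of the paper). -/
theorem stmt_9 {d m : ℕ}
    (Ω : Set (EuclideanSpace ℝ (Fin d))) (hΩopen : IsOpen Ω) (hΩconv : Convex ℝ Ω)
    (f : EuclideanSpace ℝ (Fin d) → ℝ)
    (g : EuclideanSpace ℝ (Fin d) → EuclideanSpace ℝ (Fin d))
    (c : EuclideanSpace ℝ (Fin d) → EuclideanSpace ℝ (Fin m))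
    (G : EuclideanSpace ℝ (Fin d) → (EuclideanSpace ℝ (Fin d) →L[ℝ] EuclideanSpace ℝ (Fin m)))
    (L_gradf L_G : ℝ≥0)
    (hgrad : ∀ y ∈ Ω, HasGradientAt f (g y) y)
    (hglip : LipschitzOnWith L_gradf g Ω)
    (hjac : ∀ y ∈ Ω, HasFDerivAt c (G y) y)
    (hGlip : LipschitzOnWith L_G G Ω)
    (η κ_fcd κ_g κ_f r κ_B Δmax μhat μ Δ : ℝ)
    (hη0 : 0 < η) (hη1 : η < 1) (hκfcd0 : 0 < κ_fcd) (hκfcd1 : κ_fcd ≤ 1)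
    (hκg : 0 < κ_g) (hκf : 0 < κ_f) (hr : 0 < r) (hκB : 1 ≤ κ_B)
    (hΔmax : 0 < Δmax) (hμhat : 0 < μhat)
    (x s gbar : EuclideanSpace ℝ (Fin d))
    (H : EuclideanSpace ℝ (Fin d) →L[ℝ] EuclideanSpace ℝ (Fin d))
    (τbarplus : ℝ) (hτbar0 : 0 ≤ τbarplus)
    (hx : x ∈ Ω) (hxs : x + s ∈ Ω)
    (hs : ‖s‖ ≤ Δ) (hΔ0 : 0 < Δ) (hΔ : Δ ≤ Δmax)
    (hgacc : ‖gbar - g x‖ ≤ κ_g * max 1 Δmax * Δ)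
    (hH : ‖H‖ ≤ κ_B)
    (hμ0 : 0 < μ) (hμ : μ ≤ μhat)
    (fbar_k fbar_s : ℝ)
    (hfk : |fbar_k - f x| ≤ κ_f * Δ ^ 3)
    (hfs : |fbar_s - f (x + s)| ≤ κ_f * Δ ^ 3)
    (hcr : r ≤ ‖c x‖)
    (hPred : ⟪gbar, s⟫ + 1 / 2 * ⟪s, H s⟫ + μ * (‖c x + G x s‖ - ‖c x‖) ≤
      -(κ_fcd / 2) * τbarplus * ‖c x‖ * Δ)
    (hτbarpos : 0 < τbarplus)
    (hgap : (4 * κ_f * Δmax +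
        2 * (κ_g * max 1 Δmax + 1 / 2 * ((L_gradf : ℝ) + κ_B + μhat * (L_G : ℝ)))) * Δ ≤
      (1 - η) * κ_fcd * r * τbarplus) :
    ⟪gbar, s⟫ + 1 / 2 * ⟪s, H s⟫ + μ * (‖c x + G x s‖ - ‖c x‖) < 0 ∧
      fbar_s - fbar_k + μ * (‖c (x + s)‖ - ‖c x‖) ≤
        η * (⟪gbar, s⟫ + 1 / 2 * ⟪s, H s⟫ + μ * (‖c x + G x s‖ - ‖c x‖)) := by
  have hmodel : f (x + s) - f x - ⟪g x, s⟫ ≤ L_gradf / 2 * ‖s‖ ^ 2 := by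
    have hlip : LipschitzOnWith L_gradf
        (fun y => InnerProductSpace.toDual ℝ (EuclideanSpace ℝ (Fin d)) (g y)) Ω := by
      have h := (InnerProductSpace.toDual ℝ
        (EuclideanSpace ℝ (Fin d))).lipschitz.comp_lipschitzOnWith hglip
      rwa [one_mul] at h
    have h := norm_taylor_remainder_le_of_lipschitzOnWith_fderiv hΩconv
      (fun y hy => (hgrad y hy).hasFDerivAt) hlip hx hxs
    exact (le_abs_self _).trans h
  have hcons : ‖c (x + s)‖ - ‖c x + G x s‖ ≤ L_G / 2 * ‖s‖ ^ 2 := by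
    have h := norm_taylor_remainder_le_of_lipschitzOnWith_fderiv hΩconv hjac hGlip hx hxs
    rw [sub_sub] at h
    exact (norm_sub_norm_le _ _).trans h
  have hgs : ⟪g x, s⟫ - ⟪gbar, s⟫ ≤ κ_g * max 1 Δmax * Δ ^ 2 := by
    rw [← inner_sub_left]
    calc ⟪g x - gbar, s⟫ ≤ ‖g x - gbar‖ * ‖s‖ := real_inner_le_norm _ _
      _ ≤ κ_g * max 1 Δmax * Δ * Δ := by
        rw [norm_sub_rev]
        gcongr
      _ = κ_g * max 1 Δmax * Δ ^ 2 := by ring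
  have hHs : -⟪s, H s⟫ ≤ κ_B * Δ ^ 2 := by
    calc -⟪s, H s⟫ ≤ ‖s‖ * ‖H s‖ := (neg_le_abs _).trans (abs_real_inner_le_norm _ _)
      _ ≤ ‖s‖ * (‖H‖ * ‖s‖) := by gcongr; exact H.le_opNorm s
      _ ≤ Δ * (κ_B * Δ) := by gcongr
      _ = κ_B * Δ ^ 2 := by ring
  have hfmodel : f (x + s) - f x - ⟪g x, s⟫ ≤ L_gradf / 2 * Δ ^ 2 :=
    hmodel.trans (by gcongr)
  have hmerit : μ * (‖c (x + s)‖ - ‖c x + G x s‖) ≤ μhat * (L_G / 2 * Δ ^ 2) := by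
    calc μ * (‖c (x + s)‖ - ‖c x + G x s‖) ≤ μ * (L_G / 2 * ‖s‖ ^ 2) := by gcongr
      _ ≤ μhat * (L_G / 2 * Δ ^ 2) := by gcongr
  have hnoise : κ_f * Δ ^ 3 ≤ κ_f * Δmax * Δ ^ 2 := by
    calc κ_f * Δ ^ 3 = κ_f * Δ * Δ ^ 2 := by ring
      _ ≤ κ_f * Δmax * Δ ^ 2 := by gcongr
  have hdecrease : κ_fcd * τbarplus * r * Δ ≤ κ_fcd * τbarplus * ‖c x‖ * Δ := by gcongr
  have hpos : 0 < κ_fcd * τbarplus * r * Δ := by positivity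
  have hgapΔ := mul_le_mul_of_nonneg_right hgap hΔ0.le
  have hfk' := (abs_le.1 hfk).1
  have hfs' := (abs_le.1 hfs).2
  set P := ⟪gbar, s⟫ + 1 / 2 * ⟪s, H s⟫ + μ * (‖c x + G x s‖ - ‖c x‖) with hP
  have hPr : P ≤ -(1 / 2) * (κ_fcd * τbarplus * r * Δ) := by linarith
  have hPη := mul_le_mul_of_nonneg_left hPr (sub_nonneg.2 hη1.le)
  exact ⟨by linarith, by linarith⟩
end
end

section
/- Under the stated hypotheses, the true merit-function reduction satisfies f_s − f_k + μ·(C_s − C_k) ≤ −(3·κ_fcd/(8·max{1, Δ_max}))·η³·Δ³. -/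
/-- On a successful iteration with accurate objective-value estimates, the true
merit-function reduction is at least a fixed multiple of `Δ³` (Lemma 8 of the paper). -/
theorem stmt_11
    (η κ_fcd Δmax κ_f Δ μ f_k f_s fbar_k fbar_s C_k C_s Pred : ℝ)
    (hη0 : 0 < η) (hη1 : η < 1)
    (hκfcd0 : 0 < κ_fcd) (hκfcd1 : κ_fcd ≤ 1)
    (hΔmax : 0 < Δmax)
    (hκf0 : 0 < κ_f) (hκf : κ_f ≤ κ_fcd * η ^ 3 / (16 * max 1 Δmax))
    (hΔ0 : 0 < Δ) (hΔ : Δ ≤ Δmax)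
    (hμ : 0 < μ) (hCk : 0 ≤ C_k) (hCs : 0 ≤ C_s)
    (hAredPred : fbar_s - fbar_k + μ * (C_s - C_k) ≤ η * Pred)
    (hcase :
      (|fbar_k - f_k| ≤ κ_f * Δ ^ 2 ∧ |fbar_s - f_s| ≤ κ_f * Δ ^ 2 ∧
        Pred ≤ -(κ_fcd / 2) * η ^ 2 * Δ ^ 2) ∨
      (|fbar_k - f_k| ≤ κ_f * Δ ^ 3 ∧ |fbar_s - f_s| ≤ κ_f * Δ ^ 3 ∧
        Pred ≤ -(κ_fcd / (2 * max 1 Δmax)) * η ^ 2 * Δ ^ 3)) :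
    f_s - f_k + μ * (C_s - C_k) ≤ -(3 * κ_fcd / (8 * max 1 Δmax)) * η ^ 3 * Δ ^ 3 := by
  have hM1 : 1 ≤ max 1 Δmax := le_max_left _ _
  have hΔM : Δ ≤ max 1 Δmax := hΔ.trans (le_max_right _ _)
  generalize max 1 Δmax = M at *
  have hM : 0 < M := one_pos.trans_le hM1
  obtain ⟨A, hA⟩ : ∃ A, A = κ_fcd * η ^ 3 / M := ⟨_, rfl⟩
  have hA0 : 0 < A := by rw [hA]; positivity
  have hAM : κ_fcd * η ^ 3 = A * M := by rw [hA]; field_simp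
  have hκ : κ_f ≤ A / 16 := hκf.trans_eq (by rw [hA]; field_simp)
  have hgoal : -(3 * κ_fcd / (8 * M)) * η ^ 3 * Δ ^ 3 = -(3 / 8 * (A * Δ ^ 3)) := by
    rw [hA]; field_simp
  rw [hgoal]
  rcases hcase with ⟨hk, hs, hP⟩ | ⟨hk, hs, hP⟩
  · have hP' : η * Pred ≤ -(1 / 2 * (A * M * Δ ^ 2)) :=
      (mul_le_mul_of_nonneg_left hP hη0.le).trans_eq (by rw [← hAM]; ring)
    have hκ' : κ_f * Δ ^ 2 ≤ A / 16 * Δ ^ 2 := by gcongr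
    have hΔ3 : A * Δ ^ 2 * Δ ≤ A * Δ ^ 2 * M := by gcongr
    have hΔ2 : A * Δ ^ 2 * 1 ≤ A * Δ ^ 2 * M := by gcongr
    linarith [(abs_le.mp hk).2, (abs_le.mp hs).1]
  · have hP' : η * Pred ≤ -(1 / 2 * (A * Δ ^ 3)) :=
      (mul_le_mul_of_nonneg_left hP hη0.le).trans_eq (by rw [hA]; field_simp)
    have hκ' : κ_f * Δ ^ 3 ≤ A / 16 * Δ ^ 3 := by gcongr
    linarith [(abs_le.mp hk).2, (abs_le.mp hs).1]
end

section
/- There exists a constant L > 0 such that for all x, y ∈ Ω, ‖(P(y)·g(y), c(y)) − (P(x)·g(x), c(x))‖ ≤ L·‖y − x‖, where P(x) = I − G(x)ᵀ·(G(x)·G(x)ᵀ)⁻¹·G(x) and the pair (u, v) ∈ ℝ^d × ℝ^m is regarded as a vector in ℝ^{d+m} with the Euclidean norm. -/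
open scoped RealInnerProductSpace NNReal
open ContinuousLinearMap

noncomputable section

theorem norm_rightInverse_le_of_le_inner {F : Type*} [NormedAddCommGroup F] [InnerProductSpace ℝ F]
    {T W : F →L[ℝ] F} {κ : ℝ} (hκ : 0 < κ) (h : ∀ v, κ * ‖v‖ ^ 2 ≤ ⟪T v, v⟫)
    (hW : ∀ v, T (W v) = v) : ‖W‖ ≤ κ⁻¹ := by
  refine opNorm_le_bound _ (inv_nonneg.2 hκ.le) fun v => ?_
  have h₁ : κ * ‖W v‖ ^ 2 ≤ ‖v‖ * ‖W v‖ := by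
    have := h (W v)
    rw [hW] at this
    exact this.trans (real_inner_le_norm _ _)
  rw [inv_mul_eq_div, le_div_iff₀ hκ]
  rcases (norm_nonneg (W v)).eq_or_lt with h₀ | h₀
  · rw [← h₀, zero_mul]
    exact norm_nonneg v
  · refine le_of_mul_le_mul_right ?_ h₀
    linarith

section Projection

variable {E F : Type*} [NormedAddCommGroup E] [InnerProductSpace ℝ E] [CompleteSpace E]
  [NormedAddCommGroup F] [InnerProductSpace ℝ F] [CompleteSpace F]

theorem norm_le_sqrt_of_inner_self_adjoint_le {A : E →L[ℝ] F} {κ : ℝ}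
    (h : ∀ v, ⟪A (adjoint A v), v⟫ ≤ κ * ‖v‖ ^ 2) : ‖A‖ ≤ √κ := by
  rw [← (adjoint (𝕜 := ℝ) (E := E) (F := F)).norm_map A]
  refine opNorm_le_bound _ (Real.sqrt_nonneg _) fun v => ?_
  rw [← Real.sqrt_sq (norm_nonneg v), ← Real.sqrt_mul' _ (sq_nonneg _)]
  refine Real.le_sqrt_of_sq_le ?_
  rw [← real_inner_self_eq_norm_sq, adjoint_inner_right]
  exact h v

/-- The operator `Aᵀ W A`, which is the orthogonal projection onto the range of `Aᵀ`
when `W = (A Aᵀ)⁻¹`. -/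
def rowProj (A : E →L[ℝ] F) (W : F →L[ℝ] F) : E →L[ℝ] E := (adjoint A ∘L W) ∘L A

theorem norm_adjoint_comp_le {A : E →L[ℝ] F} {W : F →L[ℝ] F} {M K : ℝ}
    (hA : ‖A‖ ≤ M) (hW : ‖W‖ ≤ K) : ‖adjoint A ∘L W‖ ≤ M * K := by
  have hM : 0 ≤ M := (norm_nonneg A).trans hA
  refine (opNorm_comp_le _ _).trans ?_
  rw [LinearIsometryEquiv.norm_map]
  gcongr

theorem norm_id_sub_rowProj_le {A : E →L[ℝ] F} {W : F →L[ℝ] F} {M K : ℝ}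
    (hA : ‖A‖ ≤ M) (hW : ‖W‖ ≤ K) : ‖.id ℝ E - rowProj A W‖ ≤ 1 + M * K * M := by
  have hM : 0 ≤ M := (norm_nonneg A).trans hA
  have hK : 0 ≤ K := (norm_nonneg W).trans hW
  refine (norm_sub_le _ _).trans (add_le_add norm_id_le ?_)
  refine (opNorm_comp_le _ _).trans ?_
  have := norm_adjoint_comp_le hA hW
  gcongr

theorem rowProj_sub_rowProj {A B : E →L[ℝ] F} {V W : F →L[ℝ] F}
    (hV : ∀ v, A (adjoint A (V v)) = v) (hW : ∀ v, W (B (adjoint B v)) = v) :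
    rowProj B W - rowProj A V =
      ((adjoint B ∘L W) ∘L (B - A)) ∘L (.id ℝ E - rowProj A V) -
        (.id ℝ E - rowProj B W) ∘L (adjoint (A - B) ∘L (V ∘L A)) := by
  ext u
  simp [rowProj, hV, hW]

theorem norm_rowProj_sub_rowProj_le {A B : E →L[ℝ] F} {V W : F →L[ℝ] F} {M K : ℝ}
    (hA : ‖A‖ ≤ M) (hB : ‖B‖ ≤ M) (hVK : ‖V‖ ≤ K) (hWK : ‖W‖ ≤ K)
    (hV : ∀ v, A (adjoint A (V v)) = v) (hW : ∀ v, W (B (adjoint B v)) = v) :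
    ‖rowProj B W - rowProj A V‖ ≤ 2 * (M * K) * (1 + M * K * M) * ‖B - A‖ := by
  have hM : 0 ≤ M := (norm_nonneg A).trans hA
  have hK : 0 ≤ K := (norm_nonneg V).trans hVK
  rw [rowProj_sub_rowProj hV hW]
  have h₁ : ‖((adjoint B ∘L W) ∘L (B - A)) ∘L (.id ℝ E - rowProj A V)‖ ≤
      M * K * ‖B - A‖ * (1 + M * K * M) := by
    refine (opNorm_comp_le _ _).trans ?_
    have := norm_id_sub_rowProj_le hA hVK
    have := (opNorm_comp_le (adjoint B ∘L W) (B - A)).trans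
      (mul_le_mul_of_nonneg_right (norm_adjoint_comp_le hB hWK) (norm_nonneg _))
    gcongr
  have h₂ : ‖(.id ℝ E - rowProj B W) ∘L (adjoint (A - B) ∘L (V ∘L A))‖ ≤
      (1 + M * K * M) * (‖B - A‖ * (K * M)) := by
    refine (opNorm_comp_le _ _).trans ?_
    have := norm_id_sub_rowProj_le hB hWK
    have : ‖adjoint (A - B) ∘L (V ∘L A)‖ ≤ ‖B - A‖ * (K * M) := by
      refine (opNorm_comp_le _ _).trans ?_
      rw [LinearIsometryEquiv.norm_map, norm_sub_rev]
      have : ‖V ∘L A‖ ≤ K * M := (opNorm_comp_le V A).trans (by gcongr)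
      gcongr
    gcongr
  refine (norm_sub_le _ _).trans ((add_le_add h₁ h₂).trans (le_of_eq ?_))
  ring

end Projection

/-- the KKT residual map `x ↦ (P(x)g(x), c(x))` is Lipschitz on `Ω`.
Here `Gᵀ` is the adjoint, `W y` plays the role of `(G(y)·G(y)ᵀ)⁻¹` for `y ∈ Ω`,
`P(y)·u = u − G(y)ᵀ·W(y)·G(y)·u`, and the pair `(u, v) ∈ ℝ^d × ℝ^m` carries the Euclidean
norm `√(‖u‖² + ‖v‖²)`. -/
theorem stmt_17 {d m : ℕ}
    (Ω : Set (EuclideanSpace ℝ (Fin d))) (hΩopen : IsOpen Ω) (hΩconv : Convex ℝ Ω)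
    (c : EuclideanSpace ℝ (Fin d) → EuclideanSpace ℝ (Fin m))
    (G : EuclideanSpace ℝ (Fin d) → (EuclideanSpace ℝ (Fin d) →L[ℝ] EuclideanSpace ℝ (Fin m)))
    (g : EuclideanSpace ℝ (Fin d) → EuclideanSpace ℝ (Fin d))
    (L_G L_gradf : ℝ≥0) (κ₁ κ₂ κ_gradf : ℝ)
    (hκ₁ : 0 < κ₁) (hκ₁₂ : κ₁ ≤ κ₂)
    (hjac : ∀ y ∈ Ω, HasFDerivAt c (G y) y)
    (hGlip : LipschitzOnWith L_G G Ω)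
    (hGlb : ∀ y ∈ Ω, ∀ v : EuclideanSpace ℝ (Fin m), κ₁ * ‖v‖ ^ 2 ≤ ⟪G y (adjoint (G y) v), v⟫)
    (hGub : ∀ y ∈ Ω, ∀ v : EuclideanSpace ℝ (Fin m), ⟪G y (adjoint (G y) v), v⟫ ≤ κ₂ * ‖v‖ ^ 2)
    (hglip : LipschitzOnWith L_gradf g Ω)
    (hgb : ∀ y ∈ Ω, ‖g y‖ ≤ κ_gradf)
    (W : EuclideanSpace ℝ (Fin d) → (EuclideanSpace ℝ (Fin m) →L[ℝ] EuclideanSpace ℝ (Fin m)))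
    (hW₁ : ∀ y ∈ Ω, ∀ v, W y (G y (adjoint (G y) v)) = v)
    (hW₂ : ∀ y ∈ Ω, ∀ v, G y (adjoint (G y) (W y v)) = v) :
    ∃ L : ℝ, 0 < L ∧ ∀ x ∈ Ω, ∀ y ∈ Ω,
      Real.sqrt (‖(g y - adjoint (G y) (W y (G y (g y)))) -
            (g x - adjoint (G x) (W x (G x (g x))))‖ ^ 2 + ‖c y - c x‖ ^ 2) ≤
        L * ‖y - x‖ := by
  set M := √κ₂
  set K := κ₁⁻¹
  set N := 1 + M * K * M
  have hM : 0 ≤ M := Real.sqrt_nonneg _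
  have hK : 0 < K := inv_pos.2 hκ₁
  have hN : 0 < N := by positivity
  have hG : ∀ y ∈ Ω, ‖G y‖ ≤ M := fun y hy => norm_le_sqrt_of_inner_self_adjoint_le (hGub y hy)
  have hW : ∀ y ∈ Ω, ‖W y‖ ≤ K := fun y hy =>
    norm_rightInverse_le_of_le_inner (T := G y ∘L adjoint (G y)) hκ₁ (hGlb y hy) (hW₂ y hy)
  refine ⟨N * L_gradf + 2 * (M * K) * N * L_G * |κ_gradf| + M + 1, by positivity,
    fun x hx y hy => ?_⟩
  have hc : ‖c y - c x‖ ≤ M * ‖y - x‖ :=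
    hΩconv.norm_image_sub_le_of_norm_hasFDerivWithin_le
      (fun z hz => (hjac z hz).hasFDerivWithinAt) hG hx hy
  have hg : ‖g y - g x‖ ≤ L_gradf * ‖y - x‖ := hglip.norm_sub_le hy hx
  have hGyx : ‖G y - G x‖ ≤ L_G * ‖y - x‖ := hGlip.norm_sub_le hy hx
  have hgx : ‖g x‖ ≤ |κ_gradf| := (hgb x hx).trans (le_abs_self _)
  have hP : ‖(g y - adjoint (G y) (W y (G y (g y)))) -
      (g x - adjoint (G x) (W x (G x (g x))))‖ ≤
      N * (L_gradf * ‖y - x‖) + 2 * (M * K) * N * (L_G * ‖y - x‖) * |κ_gradf| := by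
    have hsplit : (g y - adjoint (G y) (W y (G y (g y)))) -
        (g x - adjoint (G x) (W x (G x (g x)))) =
        (.id ℝ _ - rowProj (G y) (W y) : _ →L[ℝ] _) (g y - g x) -
          (rowProj (G y) (W y) - rowProj (G x) (W x)) (g x) := by
      simp only [rowProj, sub_apply, comp_apply, id_apply, map_sub]
      abel
    rw [hsplit]
    refine (norm_sub_le _ _).trans (add_le_add ?_ ?_)
    · exact le_of_opNorm_le_of_le _ (norm_id_sub_rowProj_le (hG y hy) (hW y hy)) hg
    · refine le_of_opNorm_le_of_le _ ((norm_rowProj_sub_rowProj_le (hG x hx) (hG y hy)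
        (hW x hx) (hW y hy) (hW₂ x hx) (hW₁ y hy)).trans ?_) hgx
      gcongr
  calc
    _ ≤ _ + ‖c y - c x‖ := Real.sqrt_le_iff.2 ⟨by positivity, by
      nlinarith [mul_nonneg (norm_nonneg ((g y - adjoint (G y) (W y (G y (g y)))) -
        (g x - adjoint (G x) (W x (G x (g x)))))) (norm_nonneg (c y - c x))]⟩
    _ ≤ _ := add_le_add hP hc
    _ ≤ _ := by linarith [norm_nonneg (y - x)]
end
end

section
/- There is a constant μ̃ > 0, determined only by κ_B, κ_c, κ_{∇f}, M, κ₁, κ₂, and Δ_max, such that for every configuration satisfying the stated hypotheses and every μ ≥ μ̃, the gradient step satisfies the sufficient-reduction condition Pred ≤ −(κ_fcd/2)·‖∇̄L‖·min{Δ, ‖∇̄L‖/‖H̄‖}, where ∇̄L = (∇̄_xL, c) ∈ ℝ^{d+m}. -/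
open scoped RealInnerProductSpace NNReal Classical
open ContinuousLinearMap

noncomputable section

/-- The Cauchy-type decrease `t ↦ t * min D (t / h)` grows at rate at most `2 * D`. -/
lemma mul_min_div_le_add {D h a t b : ℝ} (hD : 0 ≤ D) (hh : 0 < h) (ha : 0 ≤ a) (ht : 0 ≤ t)
    (hb : 0 ≤ b) (hab : a - b ≤ t) :
    a * min D (a / h) ≤ t * min D (t / h) + 2 * D * b := by
  have hDb : 0 ≤ D * b := mul_nonneg hD hb
  rcases le_total a t with hat | hta
  · have : a * min D (a / h) ≤ t * min D (t / h) :=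
      mul_le_mul hat (min_le_min le_rfl (by gcongr)) (le_min hD (by positivity)) ht
    linarith
  · have hmin : a * min D (a / h) ≤ a * D := by gcongr; exact min_le_left _ _
    have hDab : D * (a - b) ≤ D * t := mul_le_mul_of_nonneg_left hab hD
    rcases le_total D (t / h) with h1 | h1
    · rw [min_eq_left h1]
      nlinarith
    · rw [min_eq_right h1]
      have hth : h * (t / h) = t := mul_div_cancel₀ _ hh.ne'
      have hah : h * (a / h) = a := mul_div_cancel₀ _ hh.ne'
      set q := t / h
      set p := a / h
      have hq : 0 ≤ q := by positivity
      have hqp : q ≤ p := by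
        simp only [q, p]; gcongr
      rcases le_total D p with h2 | h2
      · have h3 : 0 ≤ h * (D - q) ^ 2 := by positivity
        have h4 : h * (D - q) ^ 2 = h * D ^ 2 - 2 * D * t + t * q := by
          linear_combination (q - 2 * D) * hth
        have h5 : D * (h * D) ≤ D * a := by
          rw [← hah]
          gcongr
        linarith
      · rw [min_eq_right h2]
        have h3 : 0 ≤ (a - t) * (2 * D - p - q) :=
          mul_nonneg (by linarith) (by linarith)
        have h4 : a * q = t * p := by
          linear_combination p * hth - q * hah
        linarith

lemma Real.sqrt_sq_add_sq_le {x y : ℝ} (hx : 0 ≤ x) (hy : 0 ≤ y) : √(x ^ 2 + y ^ 2) ≤ x + y :=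
  Real.sqrt_le_iff.2 ⟨by positivity, by nlinarith [mul_nonneg hx hy]⟩

/-- Comparison of the full Cauchy decrease with the one in the tangential direction, where the
radius is split according to the rescaled residuals `a / h` and `c / G`. -/
lemma sqrt_mul_min_le {a c h G Δ A κc κB r : ℝ} (ha : 0 ≤ a) (hc : 0 ≤ c) (hh : 0 < h)
    (hr : 0 < r) (hrG : r ≤ G) (hΔ : 0 < Δ) (haA : a ≤ A) (hcκ : c ≤ κc) (hB : 1 / h ≤ κB)
    (hn : 0 < √(a ^ 2 / h ^ 2 + c ^ 2 / G ^ 2)) :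
    √(a ^ 2 + c ^ 2) * min Δ (√(a ^ 2 + c ^ 2) / h) ≤
      a * min (a / h / √(a ^ 2 / h ^ 2 + c ^ 2 / G ^ 2) * Δ) (a / h) +
        (A * κB + A / r + κc / r + κc * κB) *
          (min (Δ / √(a ^ 2 / h ^ 2 + c ^ 2 / G ^ 2)) 1 * c) := by
  have hG : 0 < G := hr.trans_le hrG
  have hA : 0 ≤ A := ha.trans haA
  have hκc : 0 ≤ κc := hc.trans hcκ
  have hκB : 0 ≤ κB := le_trans (by positivity) hB
  have hLsum := Real.sqrt_sq_add_sq_le ha hc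
  have hnsum : √(a ^ 2 / h ^ 2 + c ^ 2 / G ^ 2) ≤ a / h + c / G := by
    rw [← div_pow, ← div_pow]
    exact Real.sqrt_sq_add_sq_le (by positivity) (by positivity)
  have hLsq : √(a ^ 2 + c ^ 2) ^ 2 = a ^ 2 + c ^ 2 := Real.sq_sqrt (by positivity)
  have hL0 : 0 ≤ √(a ^ 2 + c ^ 2) := Real.sqrt_nonneg _
  set L := √(a ^ 2 + c ^ 2)
  set n := √(a ^ 2 / h ^ 2 + c ^ 2 / G ^ 2)
  have hsplit : min (a / h / n * Δ) (a / h) = a / h * min (Δ / n) 1 := by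
    rw [mul_min_of_nonneg _ _ (by positivity), mul_one]
    congr 1
    ring
  have hcB : c * (1 / h) ≤ κc * κB := mul_le_mul hcκ hB (by positivity) hκc
  have haB : a * (1 / h) ≤ A * κB := mul_le_mul haA hB (by positivity) hA
  have haG : a / G ≤ A / r := div_le_div₀ hA haA hr hrG
  have hcG : c / G ≤ κc / r := div_le_div₀ hκc hcκ hr hrG
  have hAr : 0 ≤ A / r := by positivity
  have hcr : 0 ≤ κc / r := by positivity
  have hAB : 0 ≤ A * κB := by positivity
  have hcκB : 0 ≤ κc * κB := by positivity
  rw [hsplit]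
  rcases le_total (Δ / n) 1 with hs | hs
  · rw [min_eq_left hs]
    have h1 : L * n ≤ a * (a / h) + (A * κB + A / r + κc / r + κc * κB) * c := by
      calc L * n ≤ (a + c) * (a / h + c / G) := by gcongr
        _ = a * (a / h) + (a * (1 / h) + a / G + c / G) * c := by ring
        _ ≤ _ := by
          refine add_le_add_right (mul_le_mul_of_nonneg_right ?_ hc) _
          linarith
    calc L * min Δ (L / h) ≤ L * Δ := by gcongr; exact min_le_left _ _
      _ = L * n * (Δ / n) := by field_simp
      _ ≤ (a * (a / h) + (A * κB + A / r + κc / r + κc * κB) * c) * (Δ / n) := by gcongr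
      _ = _ := by ring
  · rw [min_eq_right hs]
    calc L * min Δ (L / h) ≤ L * (L / h) := by gcongr; exact min_le_right _ _
      _ = L ^ 2 / h := by ring
      _ = a * (a / h) + c * (1 / h) * c := by rw [hLsq]; ring
      _ ≤ a * (a / h) + (A * κB + A / r + κc / r + κc * κB) * c := by gcongr; linarith
      _ = _ := by ring

section Operator

variable {E F : Type*} [NormedAddCommGroup E] [InnerProductSpace ℝ E] [CompleteSpace E]
  [NormedAddCommGroup F] [InnerProductSpace ℝ F] [CompleteSpace F]

lemma inner_apply_adjoint_self (G : E →L[ℝ] F) (v : F) :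
    ⟪G (adjoint G v), v⟫ = ‖adjoint G v‖ ^ 2 := by
  rw [← adjoint_inner_right, real_inner_self_eq_norm_sq]

lemma sqrt_mul_norm_le_norm_adjoint {G : E →L[ℝ] F} {κ : ℝ} (hκ : 0 ≤ κ)
    (hG : ∀ v : F, κ * ‖v‖ ^ 2 ≤ ⟪G (adjoint G v), v⟫) (v : F) :
    √κ * ‖v‖ ≤ ‖adjoint G v‖ := by
  apply le_of_sq_le_sq _ (norm_nonneg _)
  rw [mul_pow, Real.sq_sqrt hκ, ← inner_apply_adjoint_self]
  exact hG v

lemma norm_le_sqrt_of_inner_le {G : E →L[ℝ] F} {κ : ℝ} (hκ : 0 ≤ κ)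
    (hG : ∀ v : F, ⟪G (adjoint G v), v⟫ ≤ κ * ‖v‖ ^ 2) : ‖G‖ ≤ √κ := by
  rw [← (adjoint : (E →L[ℝ] F) ≃ₗᵢ⋆[ℝ] (F →L[ℝ] E)).norm_map G]
  refine opNorm_le_bound _ (Real.sqrt_nonneg _) fun v => ?_
  apply le_of_sq_le_sq _ (by positivity)
  rw [mul_pow, Real.sq_sqrt hκ, ← inner_apply_adjoint_self]
  exact hG v

lemma sqrt_le_norm_of_le_inner [Nontrivial F] {G : E →L[ℝ] F} {κ : ℝ} (hκ : 0 ≤ κ)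
    (hG : ∀ v : F, κ * ‖v‖ ^ 2 ≤ ⟪G (adjoint G v), v⟫) : √κ ≤ ‖G‖ := by
  obtain ⟨v, hv⟩ := exists_ne (0 : F)
  rw [← (adjoint : (E →L[ℝ] F) ≃ₗᵢ⋆[ℝ] (F →L[ℝ] E)).norm_map G]
  exact le_of_mul_le_mul_right
    ((sqrt_mul_norm_le_norm_adjoint hκ hG v).trans (le_opNorm _ v)) (norm_pos_iff.2 hv)

/-- The pseudo-inverse `Gᵀ (G Gᵀ)⁻¹` has norm at most `1 / √κ`. -/
lemma sqrt_mul_norm_adjoint_apply_le_s18 {G : E →L[ℝ] F} {W : F →L[ℝ] F} {κ : ℝ} (hκ : 0 ≤ κ)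
    (hG : ∀ v : F, κ * ‖v‖ ^ 2 ≤ ⟪G (adjoint G v), v⟫)
    (hW : ∀ v, G (adjoint G (W v)) = v) (c : F) :
    √κ * ‖adjoint G (W c)‖ ≤ ‖c‖ := by
  have h1 := sqrt_mul_norm_le_norm_adjoint hκ hG (W c)
  have h2 : ‖adjoint G (W c)‖ ^ 2 ≤ ‖c‖ * ‖W c‖ := by
    rw [← inner_apply_adjoint_self, hW]
    exact real_inner_le_norm _ _
  rcases (norm_nonneg (adjoint G (W c))).eq_or_lt with h0 | h0
  · rw [← h0, mul_zero]
    exact norm_nonneg c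
  · refine le_of_mul_le_mul_right ?_ h0
    nlinarith [mul_le_mul_of_nonneg_left h2 (Real.sqrt_nonneg κ),
      mul_le_mul_of_nonneg_left h1 (norm_nonneg c)]

lemma norm_apply_of_adjoint_comp_self {Z : E →L[ℝ] F}
    (hZ : (adjoint Z).comp Z = ContinuousLinearMap.id ℝ E) (x : E) : ‖Z x‖ = ‖x‖ :=
  norm_map_iff_adjoint_comp_self Z |>.2 hZ x

end Operator

lemma abs_inner_apply_le {E : Type*} [NormedAddCommGroup E] [InnerProductSpace ℝ E]
    (H : E →L[ℝ] E) (x y : E) : |⟪x, H y⟫| ≤ ‖H‖ * ‖x‖ * ‖y‖ :=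
  calc |⟪x, H y⟫| ≤ ‖x‖ * ‖H y‖ := abs_real_inner_le_norm _ _
    _ ≤ ‖x‖ * (‖H‖ * ‖y‖) := by gcongr; exact H.le_opNorm y
    _ = _ := by ring

set_option maxHeartbeats 1000000 in
/-- existence of a merit-parameter threshold `μ̃`, determined only by
`κ_B, κ_c, κ_{∇f}, M, κ₁, κ₂, Δ_max`, beyond which the gradient step satisfies the
sufficient-reduction condition (Case 1 of Lemma 13 of the paper).  Matrices are represented
by continuous linear maps between Euclidean spaces (`Gᵀ` is the adjoint), `W` plays the role
of `(G·Gᵀ)⁻¹`, and `Z` has orthonormal columns spanning `ker G`.  The estimated Lagrangian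
gradient is `∇̄ₓL = ḡ + Gᵀλ̄ = ḡ − Gᵀ·W·G·ḡ`, and
`‖∇̄L‖ = √(‖∇̄ₓL‖² + ‖c‖²)`. -/
theorem stmt_18 (κ_B κ_c κ_gradf M κ₁ κ₂ Δmax : ℝ)
    (hκB : 0 < κ_B) (hκc : 0 < κ_c) (hκgradf : 0 < κ_gradf) (hM : 0 < M)
    (hκ₁ : 0 < κ₁) (hκ₁₂ : κ₁ ≤ κ₂) (hΔmax : 0 < Δmax) :
    ∃ μt : ℝ, 0 < μt ∧
      ∀ (κ_fcd : ℝ), 0 < κ_fcd → κ_fcd ≤ 1 →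
      ∀ (d m : ℕ), 1 ≤ m → m < d →
      ∀ (cv : EuclideanSpace ℝ (Fin m))
        (G : EuclideanSpace ℝ (Fin d) →L[ℝ] EuclideanSpace ℝ (Fin m))
        (W : EuclideanSpace ℝ (Fin m) →L[ℝ] EuclideanSpace ℝ (Fin m))
        (g gbar : EuclideanSpace ℝ (Fin d))
        (H : EuclideanSpace ℝ (Fin d) →L[ℝ] EuclideanSpace ℝ (Fin d))
        (Z : EuclideanSpace ℝ (Fin (d - m)) →L[ℝ] EuclideanSpace ℝ (Fin d))
        (Δ : ℝ) (u : EuclideanSpace ℝ (Fin (d - m))),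
        ‖cv‖ ≤ κ_c →
        (∀ v : EuclideanSpace ℝ (Fin m), κ₁ * ‖v‖ ^ 2 ≤ ⟪G (adjoint G v), v⟫) →
        (∀ v : EuclideanSpace ℝ (Fin m), ⟪G (adjoint G v), v⟫ ≤ κ₂ * ‖v‖ ^ 2) →
        (∀ v, W (G (adjoint G v)) = v) →
        (∀ v, G (adjoint G (W v)) = v) →
        ‖g‖ ≤ κ_gradf → ‖gbar - g‖ ≤ M →
        1 / κ_B ≤ ‖H‖ → ‖H‖ ≤ κ_B →
        (adjoint Z).comp Z = ContinuousLinearMap.id ℝ _ →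
        G.comp Z = 0 →
        Z.comp (adjoint Z) = ContinuousLinearMap.id ℝ _ - (adjoint G).comp (W.comp G) →
        0 < Δ → Δ ≤ Δmax →
        let barL := gbar - adjoint G (W (G gbar));
        let nRS := Real.sqrt (‖barL‖ ^ 2 / ‖H‖ ^ 2 + ‖cv‖ ^ 2 / ‖G‖ ^ 2);
        0 < nRS →
        let Δbreve := ‖cv‖ / ‖G‖ / nRS * Δ;
        let Δtilde := ‖barL‖ / ‖H‖ / nRS * Δ;
        let v := -(adjoint G) (W cv);
        let γ : ℝ := if v = 0 then 1 else min (Δbreve / ‖v‖) 1;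
        let w := γ • v;
        ‖u‖ ≤ Δtilde →
        (1 / 2 * ⟪Z u, H (Z u)⟫ + ⟪gbar + H w, Z u⟫ ≤
          -(κ_fcd / 2) * ‖adjoint Z (gbar + H w)‖ *
            min Δtilde (‖adjoint Z (gbar + H w)‖ / ‖H‖)) →
        ∀ μ : ℝ, μt ≤ μ →
        let Δx := w + Z u;
        ⟪gbar, Δx⟫ + 1 / 2 * ⟪Δx, H Δx⟫ + μ * (‖cv + G Δx‖ - ‖cv‖) ≤
          -(κ_fcd / 2) * Real.sqrt (‖barL‖ ^ 2 + ‖cv‖ ^ 2) *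
            min Δ (Real.sqrt (‖barL‖ ^ 2 + ‖cv‖ ^ 2) / ‖H‖) := by
  obtain ⟨r, hr, hrdef⟩ : ∃ r : ℝ, 0 < r ∧ r = √κ₁ := ⟨_, Real.sqrt_pos.2 hκ₁, rfl⟩
  obtain ⟨R, hR, hRdef⟩ : ∃ R : ℝ, 0 < R ∧ R = √κ₂ :=
    ⟨_, Real.sqrt_pos.2 (hκ₁.trans_le hκ₁₂), rfl⟩
  obtain ⟨A, hA, hAdef⟩ : ∃ A : ℝ, 0 < A ∧ A = κ_gradf + M := ⟨_, by positivity, rfl⟩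
  refine ⟨(A / r + κ_B * κ_c / r ^ 2 + 2 * (κ_B * Δmax / r)) +
    R / r * (A * κ_B + A / r + κ_c / r + κ_c * κ_B), by positivity, ?_⟩
  intro κ hκ hκ1 d m hm hmd cv G W g gbar H Z Δ u hc hG1 hG2 hW1 hW2 hg hgM hH1 hH2 hZ1 hGZ hZ2
    hΔ hΔm barL nRS hn Δbreve Δtilde v γ w hu hred μ hμ Δx
  have : NeZero m := ⟨by omega⟩
  have hrG : r ≤ ‖G‖ := hrdef ▸ sqrt_le_norm_of_le_inner hκ₁.le hG1
  have hGR : ‖G‖ ≤ R := hRdef ▸ norm_le_sqrt_of_inner_le (hκ₁.le.trans hκ₁₂) hG2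
  have hv : r * ‖v‖ ≤ ‖cv‖ := by
    simp only [v, norm_neg, hrdef]
    exact sqrt_mul_norm_adjoint_apply_le_s18 hκ₁.le hG1 hW2 cv
  have hGv : G v = -cv := by simp [v, hW2]
  have hh : 0 < ‖H‖ := lt_of_lt_of_le (by positivity) hH1
  have hhB : 1 / ‖H‖ ≤ κ_B := by
    rw [div_le_iff₀ hh]
    rwa [div_le_iff₀' hκB] at hH1
  have hG0 : 0 < ‖G‖ := hr.trans_le hrG
  have hgA : ‖gbar‖ ≤ A := by
    have := norm_add_le (gbar - g) g
    rw [sub_add_cancel] at this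
    linarith
  have hbarL : Z (adjoint Z gbar) = barL := by
    have := congrArg (fun T => T gbar) hZ2
    simpa [barL] using this
  have hZn := norm_apply_of_adjoint_comp_self hZ1
  have hZgbar : ‖adjoint Z gbar‖ = ‖barL‖ := by rw [← hbarL, hZn]
  have hZadj : ∀ x, ‖adjoint Z x‖ ≤ ‖x‖ := fun x => by
    refine (le_opNorm _ x).trans (mul_le_of_le_one_left (norm_nonneg x) ?_)
    rw [LinearIsometryEquiv.norm_map]
    exact opNorm_le_bound _ zero_le_one fun y => by rw [hZn, one_mul]
  have haA : ‖barL‖ ≤ A := by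
    rw [← hZgbar]
    exact (hZadj gbar).trans hgA
  have hΔt0 : 0 ≤ Δtilde := by positivity
  have hΔtΔ : Δtilde ≤ Δ := by
    have h1 : ‖barL‖ / ‖H‖ ≤ nRS := by
      apply Real.le_sqrt_of_sq_le
      rw [div_pow]
      exact le_add_of_nonneg_right (by positivity)
    exact mul_le_of_le_one_left hΔ.le ((div_le_one hn).2 h1)
  have hγ0 : 0 ≤ γ := by
    simp only [γ]
    split_ifs
    · exact zero_le_one
    · exact le_min (by positivity) zero_le_one
  have hγ1 : γ ≤ 1 := by
    simp only [γ]
    split_ifs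
    · exact le_rfl
    · exact min_le_right _ _
  have hsγ : min (Δ / nRS) 1 ≤ R / r * γ := by
    have hrR : 1 ≤ R / r := (one_le_div hr).2 (hrG.trans hGR)
    simp only [γ]
    split_ifs with hv0
    · exact (min_le_right _ _).trans (by linarith)
    · rw [mul_min_of_nonneg _ _ (by positivity), mul_one]
      refine min_le_min ?_ hrR
      have hvpos : 0 < ‖v‖ := norm_pos_iff.2 hv0
      have h1 : 1 ≤ R / r * (‖cv‖ / ‖G‖ / ‖v‖) := by
        rw [div_div, div_mul_div_comm, one_le_div (by positivity)]
        nlinarith [mul_le_mul hGR hv (by positivity) hR.le]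
      calc Δ / nRS = 1 * (Δ / nRS) := (one_mul _).symm
        _ ≤ R / r * (‖cv‖ / ‖G‖ / ‖v‖) * (Δ / nRS) := by gcongr
        _ = _ := by simp only [Δbreve]; ring
  have hwn : ‖w‖ ≤ γ * ‖cv‖ / r := by
    rw [norm_smul, Real.norm_of_nonneg hγ0, le_div_iff₀ hr, mul_assoc, mul_comm ‖v‖]
    exact mul_le_mul_of_nonneg_left hv hγ0
  have hwc : ‖w‖ ≤ κ_c / r := hwn.trans (by
    gcongr
    exact (mul_le_of_le_one_left (norm_nonneg cv) hγ1).trans hc)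
  have hZu : ‖Z u‖ ≤ Δmax := by
    rw [hZn]
    exact hu.trans (hΔtΔ.trans hΔm)
  have hfeas : ‖cv + G Δx‖ - ‖cv‖ = -(γ * ‖cv‖) := by
    have h1 : cv + G Δx = (1 - γ) • cv := by
      have h2 : G (Z u) = 0 := by
        simpa using congrArg (fun T => T u) hGZ
      simp only [Δx, w, map_add, map_smul, hGv, h2]
      module
    rw [h1, norm_smul, Real.norm_of_nonneg (by linarith)]
    ring
  have hexp : ⟪gbar, Δx⟫ + 1 / 2 * ⟪Δx, H Δx⟫ =
      (1 / 2 * ⟪Z u, H (Z u)⟫ + ⟪gbar + H w, Z u⟫) + ⟪gbar, w⟫ + 1 / 2 * ⟪w, H w⟫ +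
        1 / 2 * (⟪w, H (Z u)⟫ - ⟪Z u, H w⟫) := by
    simp only [Δx, map_add, inner_add_left, inner_add_right, real_inner_comm (Z u) (H w)]
    ring
  have hlip := mul_min_div_le_add (D := Δtilde) (h := ‖H‖) (a := ‖barL‖)
    (t := ‖adjoint Z (gbar + H w)‖) (b := ‖H‖ * ‖w‖) hΔt0 hh (norm_nonneg _) (norm_nonneg _)
    (by positivity) (by
      have h1 : adjoint Z gbar = adjoint Z (gbar + H w) - adjoint Z (H w) := by simp
      have h2 := norm_sub_le (adjoint Z (gbar + H w)) (adjoint Z (H w))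
      rw [← h1, hZgbar] at h2
      have h3 := (hZadj (H w)).trans (H.le_opNorm w)
      linarith)
  have hcmp := sqrt_mul_min_le (norm_nonneg barL) (norm_nonneg cv) hh hr hrG hΔ haA hc hhB hn
  have hy0 : 0 ≤ γ * ‖cv‖ := by positivity
  have e1 : ⟪gbar, w⟫ ≤ A / r * (γ * ‖cv‖) :=
    calc ⟪gbar, w⟫ ≤ ‖gbar‖ * ‖w‖ := real_inner_le_norm _ _
      _ ≤ A * (γ * ‖cv‖ / r) := by gcongr
      _ = _ := by ring
  have e2 : ⟪w, H w⟫ ≤ κ_B * κ_c / r ^ 2 * (γ * ‖cv‖) :=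
    calc ⟪w, H w⟫ ≤ ‖H‖ * ‖w‖ * ‖w‖ := (le_abs_self _).trans (abs_inner_apply_le H w w)
      _ ≤ κ_B * (κ_c / r) * (γ * ‖cv‖ / r) := by gcongr
      _ = _ := by ring
  have e0 : 0 ≤ κ_B * κ_c / r ^ 2 * (γ * ‖cv‖) := by positivity
  have hHw : ‖H‖ * ‖w‖ * Δmax ≤ κ_B * Δmax / r * (γ * ‖cv‖) :=
    calc ‖H‖ * ‖w‖ * Δmax ≤ κ_B * (γ * ‖cv‖ / r) * Δmax := by gcongr
      _ = _ := by ring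
  have e3 : ⟪w, H (Z u)⟫ ≤ κ_B * Δmax / r * (γ * ‖cv‖) := by
    refine ((le_abs_self _).trans (abs_inner_apply_le H w (Z u))).trans (le_trans ?_ hHw)
    gcongr
  have e4 : -⟪Z u, H w⟫ ≤ κ_B * Δmax / r * (γ * ‖cv‖) := by
    refine ((neg_le_abs _).trans (abs_inner_apply_le H (Z u) w)).trans (le_trans ?_ hHw)
    rw [mul_right_comm]
    gcongr
  have e5 : Δtilde * (‖H‖ * ‖w‖) ≤ κ_B * Δmax / r * (γ * ‖cv‖) := by
    refine le_trans ?_ hHw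
    rw [mul_comm]
    gcongr
    exact hΔtΔ.trans hΔm
  have e6 := mul_le_mul_of_nonneg_right hμ hy0
  have hK : 0 ≤ A * κ_B + A / r + κ_c / r + κ_c * κ_B := by positivity
  have e7 : (A * κ_B + A / r + κ_c / r + κ_c * κ_B) * (min (Δ / nRS) 1 * ‖cv‖) ≤
      R / r * (A * κ_B + A / r + κ_c / r + κ_c * κ_B) * (γ * ‖cv‖) :=
    calc _ ≤ (A * κ_B + A / r + κ_c / r + κ_c * κ_B) * (R / r * γ * ‖cv‖) := by gcongr
      _ = _ := by ring
  have e8 : 0 ≤ R / r * (A * κ_B + A / r + κ_c / r + κ_c * κ_B) * (γ * ‖cv‖) := by positivity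
  have e9 : 0 ≤ κ_B * Δmax / r * (γ * ‖cv‖) := by positivity
  rw [hfeas, hexp]
  change √(‖barL‖ ^ 2 + ‖cv‖ ^ 2) * min Δ (√(‖barL‖ ^ 2 + ‖cv‖ ^ 2) / ‖H‖) ≤
    ‖barL‖ * min Δtilde (‖barL‖ / ‖H‖) + (A * κ_B + A / r + κ_c / r + κ_c * κ_B) *
      (min (Δ / nRS) 1 * ‖cv‖) at hcmp
  rw [mul_assoc] at hred ⊢
  have hchain := mul_le_mul_of_nonneg_left
    (hcmp.trans (add_le_add (hlip.trans (add_le_add_right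
      (by linarith : 2 * Δtilde * (‖H‖ * ‖w‖) ≤ 2 * (κ_B * Δmax / r * (γ * ‖cv‖))) _)) e7))
    (half_pos hκ).le
  have hk1 := mul_le_mul_of_nonneg_right hκ1 e8
  have hk2 := mul_le_mul_of_nonneg_right hκ1 e9
  linarith
end
end
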